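/- arXiv:1401.4849 — 2 statements merged into one kernel-verified Lean document; each statement's English description precedes it below -/
import Mathlib

section
/- Suppose that for every pair of non-isomorphic finite trees S and T with |S| = |T| ≥ 3 one has limsup_{n→∞} P( Δ_T(PA(n,S)) > t√n ) = o( t^{2|T|−3} exp(−t²/4) ) as t → ∞. Then for every pair of non-isomorphic finite trees S and T, each on at least 3 vertices, δ(S,T) > 0; in other words, δ is a metric on isomorphism types of trees with at least 3 vertices. -/
open MeasureTheory Filter Real
open scoped ENNReal

noncomputable section

/-- The degree of vertex `v` in a graph on `ℕ`. -/
def degN (G : SimpleGraph ℕ) (v : ℕ) : ℕ := (G.neighborSet v).ncard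

/-- `G` is a tree on the vertex set `{0, …, k-1}` (all other vertices isolated). -/
def IsTreeOn (k : ℕ) (G : SimpleGraph ℕ) : Prop :=
  (∀ v w : ℕ, G.Adj v w → v < k ∧ w < k) ∧ (G.induce {v : ℕ | v < k}).IsTree

instance : MeasurableSpace (SimpleGraph ℕ) := ⊤

/-- Add the edge `uv` to `G`. -/
def addEdge (G : SimpleGraph ℕ) (u v : ℕ) : SimpleGraph ℕ :=
  G ⊔ SimpleGraph.fromEdgeSet {s(u, v)}

/-- One step of preferential attachment: the current graph has `n` vertices `0, …, n-1`;
the new vertex `n` attaches to an existing vertex `v` with probability `deg v / (2(n-1))`. -/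
def paStep (n : ℕ) (G : SimpleGraph ℕ) : Measure (SimpleGraph ℕ) :=
  Measure.sum fun v : ℕ =>
    ((degN G v : ℝ≥0∞) / ((2 * (n - 1) : ℕ) : ℝ≥0∞)) • Measure.dirac (addEdge G n v)

def PAlawAux (k : ℕ) (T : SimpleGraph ℕ) : ℕ → Measure (SimpleGraph ℕ)
  | 0 => Measure.dirac T
  | m + 1 => (PAlawAux k T m).bind (paStep (k + m))

/-- The law of `PA(n, T)` for a seed tree `T` on `k` vertices, as a measure on labelled
graphs on `ℕ` (vertices are labelled `0, 1, 2, …` in order of arrival). -/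
def PAlaw (k : ℕ) (T : SimpleGraph ℕ) (n : ℕ) : Measure (SimpleGraph ℕ) :=
  PAlawAux k T (n - k)

/-- Graphs on `ℕ` up to isomorphism. -/
def graphSetoid : Setoid (SimpleGraph ℕ) where
  r G H := Nonempty (G ≃g H)
  iseqv := ⟨fun G => ⟨RelIso.refl G.Adj⟩, fun ⟨e⟩ => ⟨e.symm⟩, fun ⟨e⟩ ⟨f⟩ => ⟨e.trans f⟩⟩

/-- Isomorphism types of graphs on `ℕ`. -/
def GraphType : Type := Quotient graphSetoid

instance : MeasurableSpace GraphType := ⊤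

/-- The law of the isomorphism type of `PA(n, T)`. -/
def PAtype (k : ℕ) (T : SimpleGraph ℕ) (n : ℕ) : Measure GraphType :=
  (PAlaw k T n).map (Quotient.mk graphSetoid)

/-- Total variation distance between two measures. -/
def tvDist {α : Type*} [MeasurableSpace α] (μ ν : Measure α) : ℝ :=
  ⨆ A : Set α, |(μ A).toReal - (ν A).toReal|

/-- `δ(S, T) = lim_n TV(PA(n,S), PA(n,T))`, the total variation distance being taken
between the laws of the isomorphism types.  The limit exists since the sequence is
non-increasing; we express it as a `limsup`, which agrees with the limit. -/
def deltaPA (kS : ℕ) (S : SimpleGraph ℕ) (kT : ℕ) (T : SimpleGraph ℕ) : ℝ :=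
  Filter.limsup (fun n : ℕ => tvDist (PAtype kS S n) (PAtype kT T n)) Filter.atTop


/-- The `U`-maximum degree `Δ_U(G)` of `G`, where `U` is a graph on `{0, …, kU-1}`:
the maximum over all injective graph homomorphisms `φ` from `U` to `G` of
`∑_{u ∈ V(U)} deg_G (φ u)` (zero if no such homomorphism exists). -/
def UmaxDeg (kU : ℕ) (U G : SimpleGraph ℕ) : ℕ :=
  sSup {d : ℕ | ∃ φ : ℕ → ℕ, Set.InjOn φ (Set.Iio kU) ∧
    (∀ a b : ℕ, U.Adj a b → G.Adj (φ a) (φ b)) ∧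
    d = ∑ i ∈ Finset.range kU, degN G (φ i)}

instance : DiscreteMeasurableSpace (SimpleGraph ℕ) := ⟨fun _ => trivial⟩

instance : DiscreteMeasurableSpace GraphType := ⟨fun _ => trivial⟩

/-- All edges of `G` lie inside `{0, …, n-1}`. -/
def SupportedOn (n : ℕ) (G : SimpleGraph ℕ) : Prop :=
  ∀ v w : ℕ, G.Adj v w → v < n ∧ w < n

theorem SupportedOn.neighborSet_subset {n : ℕ} {G : SimpleGraph ℕ} (h : SupportedOn n G) (v : ℕ) :
    G.neighborSet v ⊆ Set.Iio n := fun _ hw => (h _ _ hw).2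

theorem SupportedOn.finite_neighborSet {n : ℕ} {G : SimpleGraph ℕ} (h : SupportedOn n G) (v : ℕ) :
    (G.neighborSet v).Finite := (Set.finite_Iio n).subset (h.neighborSet_subset v)

theorem SupportedOn.degN_le {n : ℕ} {G : SimpleGraph ℕ} (h : SupportedOn n G) (v : ℕ) :
    degN G v ≤ n := by
  have := Set.ncard_le_ncard (h.neighborSet_subset v) (Set.finite_Iio n)
  simpa [degN, Set.ncard_eq_toFinset_card'] using this

theorem SupportedOn.degN_eq_zero {n : ℕ} {G : SimpleGraph ℕ} (h : SupportedOn n G) {v : ℕ}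
    (hv : n ≤ v) : degN G v = 0 := by
  have : G.neighborSet v = ∅ := by
    ext w
    simp only [SimpleGraph.mem_neighborSet, Set.mem_empty_iff_false, iff_false]
    intro hw
    have := (h _ _ hw).1
    omega
  simp [degN, this]

theorem addEdge_adj {G : SimpleGraph ℕ} {n v : ℕ} (hv : v ≠ n) (a b : ℕ) :
    (addEdge G n v).Adj a b ↔ G.Adj a b ∨ (a = n ∧ b = v) ∨ (a = v ∧ b = n) := by
  simp only [addEdge, SimpleGraph.sup_adj, SimpleGraph.fromEdgeSet_adj, Set.mem_singleton_iff,
    Sym2.eq_iff]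
  constructor
  · rintro (h | ⟨h, -⟩)
    · exact Or.inl h
    · exact Or.inr h
  · rintro (h | ⟨rfl, rfl⟩ | ⟨rfl, rfl⟩)
    · exact Or.inl h
    · exact Or.inr ⟨Or.inl ⟨rfl, rfl⟩, hv.symm⟩
    · exact Or.inr ⟨Or.inr ⟨rfl, rfl⟩, hv⟩

theorem SupportedOn.addEdge {n : ℕ} {G : SimpleGraph ℕ} (h : SupportedOn n G) {v : ℕ}
    (hv : v < n) : SupportedOn (n + 1) (addEdge G n v) := by
  intro a b hab
  rcases (addEdge_adj hv.ne a b).1 hab with hab | ⟨rfl, rfl⟩ | ⟨rfl, rfl⟩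
  · have := h a b hab
    omega
  · omega
  · omega

theorem SupportedOn.degN_addEdge_self {n : ℕ} {G : SimpleGraph ℕ} (h : SupportedOn n G) {v : ℕ}
    (hv : v < n) : degN (_root_.addEdge G n v) v = degN G v + 1 := by
  have hn : n ∉ G.neighborSet v := fun hw => (h _ _ hw).2.ne rfl
  have : (_root_.addEdge G n v).neighborSet v = insert n (G.neighborSet v) := by
    ext w
    simp only [SimpleGraph.mem_neighborSet, addEdge_adj hv.ne, Set.mem_insert_iff]
    have := hv.ne
    tauto
  rw [degN, this, Set.ncard_insert_of_notMem hn (h.finite_neighborSet v), degN]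

theorem SupportedOn.degN_addEdge_new {n : ℕ} {G : SimpleGraph ℕ} (h : SupportedOn n G) {v : ℕ}
    (hv : v < n) : degN (_root_.addEdge G n v) n = 1 := by
  have : (_root_.addEdge G n v).neighborSet n = {v} := by
    ext w
    simp only [SimpleGraph.mem_neighborSet, addEdge_adj hv.ne, Set.mem_singleton_iff]
    have h1 := hv.ne
    have h2 : ¬ G.Adj n w := fun hw => (h _ _ hw).1.ne rfl
    tauto
  rw [degN, this, Set.ncard_singleton]

theorem degN_addEdge_of_ne {n : ℕ} {G : SimpleGraph ℕ} {v w : ℕ}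
    (hv : v < n) (hwv : w ≠ v) (hwn : w ≠ n) : degN (addEdge G n v) w = degN G w := by
  have : (addEdge G n v).neighborSet w = G.neighborSet w := by
    ext u
    simp only [SimpleGraph.mem_neighborSet, addEdge_adj hv.ne]
    tauto
  rw [degN, this, degN]

/-- The total degree of the vertices `0, …, k-1`. -/
def seedDeg (k : ℕ) (G : SimpleGraph ℕ) : ℕ := ∑ i ∈ Finset.range k, degN G i

theorem SupportedOn.seedDeg_addEdge {k n : ℕ} {G : SimpleGraph ℕ} (h : SupportedOn n G)
    (hk : k ≤ n) {v : ℕ} (hv : v < n) :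
    seedDeg k (_root_.addEdge G n v) = seedDeg k G + if v < k then 1 else 0 := by
  have key : ∀ i ∈ Finset.range k,
      degN (_root_.addEdge G n v) i = degN G i + if i = v then 1 else 0 := by
    intro i hi
    have hi := Finset.mem_range.1 hi
    split_ifs with hiv
    · rw [hiv, h.degN_addEdge_self hv]
    · rw [degN_addEdge_of_ne hv hiv (by omega), add_zero]
  rw [seedDeg, Finset.sum_congr rfl key, Finset.sum_add_distrib, Finset.sum_ite_eq', seedDeg]
  simp

theorem SupportedOn.seedDeg_addEdge_succ {n : ℕ} {G : SimpleGraph ℕ} (h : SupportedOn n G)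
    {v : ℕ} (hv : v < n) :
    seedDeg (n + 1) (_root_.addEdge G n v) = seedDeg n G + 2 := by
  have h1 := h.seedDeg_addEdge le_rfl hv
  rw [if_pos hv] at h1
  have h2 : seedDeg (n + 1) (_root_.addEdge G n v)
      = seedDeg n (_root_.addEdge G n v) + degN (_root_.addEdge G n v) n :=
    Finset.sum_range_succ _ _
  rw [h2, h1, h.degN_addEdge_new hv]

theorem SupportedOn.ncard_edgeSet_induce {n : ℕ} {G : SimpleGraph ℕ} (h : SupportedOn n G) :
    2 * Nat.card (G.induce {v : ℕ | v < n}).edgeSet = seedDeg n G := by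
  classical
  have hdeg : ∀ v : {v : ℕ | v < n}, (G.induce {v : ℕ | v < n}).degree v = degN G v := by
    intro v
    have : G.neighborSet v = Subtype.val '' (G.induce {v : ℕ | v < n}).neighborSet v := by
      ext w
      simp only [SimpleGraph.mem_neighborSet, Set.mem_image, SimpleGraph.comap_adj,
        Function.Embedding.subtype_apply, Subtype.exists, Set.mem_ofPred_eq]
      constructor
      · exact fun hw => ⟨w, (h _ _ hw).2, hw, rfl⟩
      · rintro ⟨w, _, hw, rfl⟩
        exact hw
    rw [degN, this, Set.ncard_image_of_injective _ Subtype.val_injective,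
      Set.ncard_eq_toFinset_card', SimpleGraph.degree, SimpleGraph.neighborFinset]
  have hsum := (G.induce {v : ℕ | v < n}).sum_degrees_eq_twice_card_edges
  rw [SimpleGraph.edgeFinset, Set.toFinset_card] at hsum
  rw [Nat.card_eq_fintype_card, ← hsum, Finset.sum_congr rfl (fun v _ => hdeg v), seedDeg]
  symm
  refine Finset.sum_subtype _ (fun v => ?_) _
  simp

theorem isTreeOn_iff {n : ℕ} {G : SimpleGraph ℕ} :
    IsTreeOn n G ↔ SupportedOn n G ∧ (G.induce {v : ℕ | v < n}).Connected ∧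
      seedDeg n G + 2 = 2 * n := by
  have hn : Nat.card {v : ℕ | v < n} = n := by simp
  constructor
  · rintro ⟨h1, h2⟩
    have h1 : SupportedOn n G := h1
    obtain ⟨h3, h4⟩ := SimpleGraph.isTree_iff_connected_and_card.1 h2
    refine ⟨h1, h3, ?_⟩
    rw [← h1.ncard_edgeSet_induce]
    omega
  · rintro ⟨h1, h2, h3⟩
    refine ⟨h1, SimpleGraph.isTree_iff_connected_and_card.2 ⟨h2, ?_⟩⟩
    rw [← h1.ncard_edgeSet_induce] at h3
    omega

theorem IsTreeOn.supportedOn {n : ℕ} {G : SimpleGraph ℕ} (h : IsTreeOn n G) : SupportedOn n G := h.1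

theorem IsTreeOn.seedDeg_add_two {n : ℕ} {G : SimpleGraph ℕ} (h : IsTreeOn n G) :
    seedDeg n G + 2 = 2 * n := (isTreeOn_iff.1 h).2.2

theorem IsTreeOn.addEdge {n : ℕ} {G : SimpleGraph ℕ} (h : IsTreeOn n G) {v : ℕ} (hv : v < n) :
    IsTreeOn (n + 1) (addEdge G n v) := by
  obtain ⟨h1, h2, h3⟩ := isTreeOn_iff.1 h
  refine isTreeOn_iff.2 ⟨h1.addEdge hv, ?_, ?_⟩
  · rw [SimpleGraph.connected_iff_exists_forall_reachable]
    have hv' : v < n + 1 := by omega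
    refine ⟨⟨v, hv'⟩, ?_⟩
    rintro ⟨w, hw⟩
    have hw : w < n + 1 := hw
    rcases Nat.lt_succ_iff_lt_or_eq.1 hw with hwn | rfl
    · let f : G.induce {v : ℕ | v < n} →g (_root_.addEdge G n v).induce {v : ℕ | v < n + 1} :=
        { toFun := fun x => ⟨x.1, Nat.lt_succ_of_lt x.2⟩
          map_rel' := fun {a b} hab => (addEdge_adj hv.ne _ _).2 (Or.inl hab) }
      exact (h2.preconnected ⟨v, hv⟩ ⟨w, hwn⟩).map f
    · refine SimpleGraph.Adj.reachable ?_
      exact (addEdge_adj hv.ne _ _).2 (Or.inr (Or.inr ⟨rfl, rfl⟩))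
  · rw [h1.seedDeg_addEdge_succ hv]
    omega

theorem IsTreeOn.exists_leaf {n : ℕ} {G : SimpleGraph ℕ} (h : IsTreeOn n G) (hn : 2 ≤ n) :
    ∃ v < n, degN G v = 1 := by
  have h1 := h.supportedOn
  have hpos : ∀ v < n, 1 ≤ degN G v := by
    intro v hv
    have : Nontrivial {v : ℕ | v < n} :=
      ⟨⟨⟨0, show 0 < n by omega⟩, ⟨1, show 1 < n by omega⟩, by simp⟩⟩
    obtain ⟨w, hw⟩ := h.2.1.preconnected.exists_adj_of_nontrivial ⟨v, hv⟩
    refine (Set.ncard_pos (h1.finite_neighborSet v)).2 ⟨w.1, hw⟩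
  by_contra! hcon
  have h2 : ∑ i ∈ Finset.range n, 2 ≤ seedDeg n G := by
    refine Finset.sum_le_sum fun i hi => ?_
    have hi := Finset.mem_range.1 hi
    have := hpos i hi
    have := hcon i hi
    omega
  have h3 := h.seedDeg_add_two
  simp at h2
  omega

theorem IsTreeOn.exists_two_le_degN {n : ℕ} {G : SimpleGraph ℕ} (h : IsTreeOn n G) (hn : 3 ≤ n) :
    ∃ v < n, 2 ≤ degN G v := by
  by_contra! hcon
  have h2 : seedDeg n G ≤ ∑ i ∈ Finset.range n, 1 :=
    Finset.sum_le_sum fun i hi => Nat.lt_succ_iff.1 (hcon i (Finset.mem_range.1 hi))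
  have h3 := h.seedDeg_add_two
  simp at h2
  omega

theorem degN_eq_of_iso {G H : SimpleGraph ℕ} (e : G ≃g H) (v : ℕ) :
    degN H (e v) = degN G v := by
  have : H.neighborSet (e v) = e '' G.neighborSet v := by
    ext w
    simp only [SimpleGraph.mem_neighborSet, Set.mem_image]
    constructor
    · intro hw
      refine ⟨e.symm w, ?_, e.apply_symm_apply w⟩
      rw [← e.map_adj_iff, e.apply_symm_apply]
      exact hw
    · rintro ⟨u, hu, rfl⟩
      exact e.map_adj_iff.2 hu
  rw [degN, this, Set.ncard_image_of_injective _ e.injective, degN]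

theorem UmaxDeg_le_of_iso {k : ℕ} {U G H : SimpleGraph ℕ} (e : G ≃g H) :
    {d : ℕ | ∃ φ : ℕ → ℕ, Set.InjOn φ (Set.Iio k) ∧
      (∀ a b : ℕ, U.Adj a b → G.Adj (φ a) (φ b)) ∧ d = ∑ i ∈ Finset.range k, degN G (φ i)} ⊆
    {d : ℕ | ∃ φ : ℕ → ℕ, Set.InjOn φ (Set.Iio k) ∧
      (∀ a b : ℕ, U.Adj a b → H.Adj (φ a) (φ b)) ∧ d = ∑ i ∈ Finset.range k, degN H (φ i)} := by
  rintro d ⟨φ, h1, h2, h3⟩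
  refine ⟨fun i => e (φ i), fun a ha b hb hab => h1 ha hb (e.injective hab),
    fun a b hab => e.map_adj_iff.2 (h2 a b hab), ?_⟩
  rw [h3]
  exact Finset.sum_congr rfl fun i _ => (degN_eq_of_iso e _).symm

theorem UmaxDeg_eq_of_iso {k : ℕ} {U G H : SimpleGraph ℕ} (e : G ≃g H) :
    UmaxDeg k U G = UmaxDeg k U H :=
  congrArg sSup (Set.Subset.antisymm (UmaxDeg_le_of_iso e) (UmaxDeg_le_of_iso e.symm))

theorem SupportedOn.seedDeg_le_UmaxDeg {k n : ℕ} {U G : SimpleGraph ℕ} (h : SupportedOn n G)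
    (hUG : U ≤ G) : seedDeg k G ≤ UmaxDeg k U G := by
  refine le_csSup ⟨k * n, ?_⟩ ⟨id, Set.injOn_id _, fun a b hab => hUG hab, rfl⟩
  rintro d ⟨φ, -, -, rfl⟩
  calc _ ≤ ∑ i ∈ Finset.range k, n := Finset.sum_le_sum fun i _ => h.degN_le _
    _ = k * n := by simp

theorem SupportedOn.lintegral_paStep {n : ℕ} {G : SimpleGraph ℕ} (h : SupportedOn n G)
    (f : SimpleGraph ℕ → ℝ≥0∞) :
    ∫⁻ H, f H ∂(paStep n G) =
      ∑ v ∈ Finset.range n,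
        ((degN G v : ℝ≥0∞) / ((2 * (n - 1) : ℕ) : ℝ≥0∞)) * f (_root_.addEdge G n v) := by
  rw [paStep, lintegral_sum_measure, tsum_eq_sum (s := Finset.range n)]
  · refine Finset.sum_congr rfl fun v _ => ?_
    rw [lintegral_smul_measure, lintegral_dirac, smul_eq_mul]
  · intro v hv
    have hv : n ≤ v := by simpa using hv
    rw [h.degN_eq_zero hv]
    simp

theorem SupportedOn.sum_degN_mul_ascFactorial {k n : ℕ} {G : SimpleGraph ℕ}
    (h : SupportedOn n G) (hk : k ≤ n) (r : ℕ) :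
    ∑ v ∈ Finset.range n,
        degN G v * (seedDeg k (_root_.addEdge G n v)).ascFactorial r =
      (seedDeg n G + r) * (seedDeg k G).ascFactorial r := by
  have hsplit : seedDeg n G = seedDeg k G + ∑ v ∈ Finset.Ico k n, degN G v :=
    (Finset.sum_range_add_sum_Ico _ hk).symm
  have h1 : ∑ v ∈ Finset.range k,
      degN G v * (seedDeg k (_root_.addEdge G n v)).ascFactorial r =
      seedDeg k G * (seedDeg k G).succ.ascFactorial r := by
    rw [seedDeg, Finset.sum_mul]
    refine Finset.sum_congr rfl fun v hv => ?_
    have hv := Finset.mem_range.1 hv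
    rw [h.seedDeg_addEdge hk (hv.trans_le hk), if_pos hv, seedDeg]
  have h2 : ∑ v ∈ Finset.Ico k n,
      degN G v * (seedDeg k (_root_.addEdge G n v)).ascFactorial r =
      (∑ v ∈ Finset.Ico k n, degN G v) * (seedDeg k G).ascFactorial r := by
    rw [Finset.sum_mul]
    refine Finset.sum_congr rfl fun v hv => ?_
    obtain ⟨hv1, hv2⟩ := Finset.mem_Ico.1 hv
    rw [h.seedDeg_addEdge hk hv2, if_neg (by omega), add_zero]
  rw [← Finset.sum_range_add_sum_Ico _ hk, h1, h2, Nat.succ_ascFactorial, hsplit]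
  ring

theorem IsTreeOn.lintegral_ascFactorial_paStep {k N : ℕ} {G : SimpleGraph ℕ}
    (h : IsTreeOn (N + 1) G) (hk : k ≤ N + 1) (hN : N ≠ 0) (s : ℕ) :
    (N : ℝ≥0∞) * ∫⁻ H, ((seedDeg k H).ascFactorial (2 * s) : ℝ≥0∞) ∂(paStep (N + 1) G) =
      ((N + s : ℕ) : ℝ≥0∞) * ((seedDeg k G).ascFactorial (2 * s) : ℝ≥0∞) := by
  have hdeg : seedDeg (N + 1) G = 2 * N := by
    have := h.seedDeg_add_two
    omega
  have hsum := h.supportedOn.sum_degN_mul_ascFactorial hk (2 * s)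
  rw [hdeg] at hsum
  rw [h.supportedOn.lintegral_paStep, Nat.add_sub_cancel]
  have h2N : ((2 * N : ℕ) : ℝ≥0∞) ≠ 0 := by
    rw [Nat.cast_ne_zero]
    omega
  have key : ∑ v ∈ Finset.range (N + 1), ((degN G v : ℝ≥0∞) / ((2 * N : ℕ) : ℝ≥0∞)) *
        ((seedDeg k (_root_.addEdge G (N + 1) v)).ascFactorial (2 * s) : ℝ≥0∞) =
      ((2 * N : ℕ) : ℝ≥0∞)⁻¹ *
        (((2 * N + 2 * s) * (seedDeg k G).ascFactorial (2 * s) : ℕ) : ℝ≥0∞) := by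
    rw [← hsum, Nat.cast_sum, Finset.mul_sum]
    refine Finset.sum_congr rfl fun v _ => ?_
    rw [ENNReal.div_eq_inv_mul, mul_assoc, ← Nat.cast_mul]
  rw [key, ← (ENNReal.mul_right_inj (a := 2) two_ne_zero ENNReal.ofNat_ne_top), ← mul_assoc,
    ← mul_assoc]
  have : (2 : ℝ≥0∞) * N = ((2 * N : ℕ) : ℝ≥0∞) := by push_cast; ring
  rw [this, ENNReal.mul_inv_cancel h2N (ENNReal.natCast_ne_top _), one_mul]
  push_cast
  ring

theorem lintegral_PAlawAux_succ (k : ℕ) (T : SimpleGraph ℕ) (m : ℕ)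
    (f : SimpleGraph ℕ → ℝ≥0∞) :
    ∫⁻ G, f G ∂(PAlawAux k T (m + 1)) =
      ∫⁻ G, ∫⁻ H, f H ∂(paStep (k + m) G) ∂(PAlawAux k T m) :=
  Measure.lintegral_bind Measurable.of_discrete.aemeasurable Measurable.of_discrete.aemeasurable

theorem PAlawAux_succ_apply (k : ℕ) (T : SimpleGraph ℕ) (m : ℕ) (A : Set (SimpleGraph ℕ)) :
    PAlawAux k T (m + 1) A = ∫⁻ G, paStep (k + m) G A ∂(PAlawAux k T m) :=
  Measure.bind_apply (MeasurableSet.of_discrete) Measurable.of_discrete.aemeasurable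

theorem SupportedOn.paStep_apply_eq_zero {n : ℕ} {G : SimpleGraph ℕ} (h : SupportedOn n G)
    {A : Set (SimpleGraph ℕ)} (hA : ∀ v < n, _root_.addEdge G n v ∉ A) : paStep n G A = 0 := by
  rw [← lintegral_indicator_one MeasurableSet.of_discrete, h.lintegral_paStep]
  refine Finset.sum_eq_zero fun v hv => ?_
  rw [Set.indicator_of_notMem (hA v (Finset.mem_range.1 hv)), mul_zero]

theorem IsTreeOn.ae_PAlawAux {k : ℕ} {T : SimpleGraph ℕ} (hT : IsTreeOn k T) (m : ℕ) :
    ∀ᵐ G ∂(PAlawAux k T m), IsTreeOn (k + m) G ∧ T ≤ G := by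
  induction m with
  | zero =>
    rw [PAlawAux, ae_dirac_eq]
    exact ⟨hT, le_rfl⟩
  | succ m ih =>
    rw [ae_iff, PAlawAux_succ_apply, lintegral_eq_zero_iff Measurable.of_discrete]
    filter_upwards [ih] with G hG
    refine hG.1.supportedOn.paStep_apply_eq_zero fun v hv hmem => hmem ?_
    exact ⟨hG.1.addEdge hv, hG.2.trans le_sup_left⟩

theorem IsTreeOn.lintegral_ascFactorial {N : ℕ} {T : SimpleGraph ℕ} (hT : IsTreeOn (N + 1) T)
    (hN : N ≠ 0) (s m : ℕ) :
    (∫⁻ G, ((seedDeg (N + 1) G).ascFactorial (2 * s) : ℝ≥0∞) ∂(PAlawAux (N + 1) T m)) *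
        (N.ascFactorial s : ℝ≥0∞) =
      ((2 * N).ascFactorial (2 * s) : ℝ≥0∞) * ((N + m).ascFactorial s : ℝ≥0∞) := by
  induction m with
  | zero =>
    have : _root_.seedDeg (N + 1) T = 2 * N := by
      have := hT.seedDeg_add_two
      omega
    rw [PAlawAux, lintegral_dirac, this, add_zero]
  | succ m ih =>
    have hM : ((N + m : ℕ) : ℝ≥0∞) ≠ 0 := by
      rw [Nat.cast_ne_zero]
      omega
    rw [← ENNReal.mul_right_inj hM (ENNReal.natCast_ne_top _), ← mul_assoc,
      lintegral_PAlawAux_succ, ← lintegral_const_mul _ Measurable.of_discrete]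
    have hstep : ∀ᵐ G ∂(PAlawAux (N + 1) T m), ((N + m : ℕ) : ℝ≥0∞) *
        ∫⁻ H, ((_root_.seedDeg (N + 1) H).ascFactorial (2 * s) : ℝ≥0∞) ∂(paStep (N + 1 + m) G) =
        ((N + m + s : ℕ) : ℝ≥0∞) *
          ((_root_.seedDeg (N + 1) G).ascFactorial (2 * s) : ℝ≥0∞) := by
      filter_upwards [hT.ae_PAlawAux m] with G hG
      have hidx : N + 1 + m = N + m + 1 := by ring
      rw [hidx] at hG ⊢
      exact hG.1.lintegral_ascFactorial_paStep (by omega) (by omega) s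
    rw [lintegral_congr_ae hstep, lintegral_const_mul _ Measurable.of_discrete, mul_assoc, ih]
    have := Nat.succ_ascFactorial (N + m) s
    rw [mul_left_comm, mul_left_comm _ ((2 * N).ascFactorial (2 * s) : ℝ≥0∞)]
    congr 1
    exact_mod_cast this.symm

theorem IsTreeOn.isProbabilityMeasure_PAlawAux {k : ℕ} {T : SimpleGraph ℕ} (hT : IsTreeOn k T)
    (hk : 2 ≤ k) (m : ℕ) : IsProbabilityMeasure (PAlawAux k T m) := by
  obtain ⟨N, rfl⟩ : ∃ N, k = N + 1 := ⟨k - 1, by omega⟩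
  have := hT.lintegral_ascFactorial (by omega) 0 m
  constructor
  simpa using this

theorem IsTreeOn.isProbabilityMeasure_PAlaw {k : ℕ} {T : SimpleGraph ℕ} (hT : IsTreeOn k T)
    (hk : 2 ≤ k) (n : ℕ) : IsProbabilityMeasure (PAlaw k T n) :=
  hT.isProbabilityMeasure_PAlawAux hk _

theorem IsTreeOn.isProbabilityMeasure_PAtype {k : ℕ} {T : SimpleGraph ℕ} (hT : IsTreeOn k T)
    (hk : 2 ≤ k) (n : ℕ) : IsProbabilityMeasure (PAtype k T n) :=
  have := hT.isProbabilityMeasure_PAlaw hk n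
  Measure.isProbabilityMeasure_map Measurable.of_discrete.aemeasurable

theorem smul_PAlawAux_le {k j : ℕ} {S R : SimpleGraph ℕ} (m : ℕ) :
    (PAlawAux k S j {R}) • PAlawAux (k + j) R m ≤ PAlawAux k S (j + m) := by
  induction m with
  | zero =>
    refine Measure.le_iff.2 fun A _ => ?_
    rw [PAlawAux, Measure.smul_apply, smul_eq_mul, Measure.dirac_apply, add_zero]
    by_cases hR : R ∈ A
    · rw [Set.indicator_of_mem hR, Pi.one_apply, mul_one]
      exact measure_mono (by simpa using hR)
    · simp [hR]
  | succ m ih =>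
    refine Measure.le_iff.2 fun A _ => ?_
    rw [← add_assoc, PAlawAux_succ_apply, Measure.smul_apply, PAlawAux_succ_apply, smul_eq_mul,
      ← smul_eq_mul, ← lintegral_smul_measure, add_assoc]
    exact lintegral_mono' ih le_rfl

theorem PAlawAux_singleton_addEdge_ne_zero {k j : ℕ} {S R : SimpleGraph ℕ} {v : ℕ}
    (hR : SupportedOn (k + j) R) (h : PAlawAux k S j {R} ≠ 0) (hv : v < k + j)
    (hdeg : degN R v ≠ 0) : PAlawAux k S (j + 1) {addEdge R (k + j) v} ≠ 0 := by
  have h1 := smul_PAlawAux_le (k := k) (j := j) (S := S) (R := R) 1 {addEdge R (k + j) v}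
  refine fun h0 => ?_
  rw [h0, nonpos_iff_eq_zero, Measure.smul_apply, smul_eq_mul, mul_eq_zero, or_iff_right h,
    PAlawAux_succ_apply, PAlawAux, lintegral_dirac, add_zero,
    ← lintegral_indicator_one MeasurableSet.of_discrete, hR.lintegral_paStep,
    Finset.sum_eq_zero_iff] at h1
  have := h1 v (Finset.mem_range.2 hv)
  simp [hdeg, ENNReal.mul_eq_top] at this

theorem PAlawAux_zero_singleton (k : ℕ) (S : SimpleGraph ℕ) : PAlawAux k S 0 {S} = 1 := by
  rw [PAlawAux, Measure.dirac_apply, Set.indicator_of_mem (Set.mem_singleton S), Pi.one_apply]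

theorem IsTreeOn.exists_large_degN {k : ℕ} {S : SimpleGraph ℕ} (hS : IsTreeOn k S) {v : ℕ}
    (hv : v < k) (hdeg : degN S v ≠ 0) (j : ℕ) :
    ∃ R, IsTreeOn (k + j) R ∧ PAlawAux k S j {R} ≠ 0 ∧ degN R v = degN S v + j := by
  induction j with
  | zero => exact ⟨S, hS, by rw [PAlawAux_zero_singleton]; exact one_ne_zero, rfl⟩
  | succ j ih =>
    obtain ⟨R, hR, hmass, hRv⟩ := ih
    have hvj : v < k + j := by omega
    refine ⟨_root_.addEdge R (k + j) v, hR.addEdge hvj,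
      PAlawAux_singleton_addEdge_ne_zero hR.supportedOn hmass hvj (by omega), ?_⟩
    rw [hR.supportedOn.degN_addEdge_self hvj, hRv, add_assoc]

theorem IsTreeOn.exists_bounded_degN {k : ℕ} {S : SimpleGraph ℕ} (hS : IsTreeOn k S)
    (hk : 2 ≤ k) {d : ℕ} (hd : 2 ≤ d) (hdeg : ∀ v, degN S v ≤ d) (j : ℕ) :
    ∃ R, IsTreeOn (k + j) R ∧ PAlawAux k S j {R} ≠ 0 ∧ ∀ v, degN R v ≤ d := by
  induction j with
  | zero => exact ⟨S, hS, by rw [PAlawAux_zero_singleton]; exact one_ne_zero, hdeg⟩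
  | succ j ih =>
    obtain ⟨R, hR, hmass, hRd⟩ := ih
    obtain ⟨v, hv, hv1⟩ := hR.exists_leaf (by omega)
    refine ⟨_root_.addEdge R (k + j) v, hR.addEdge hv,
      PAlawAux_singleton_addEdge_ne_zero hR.supportedOn hmass hv (by omega), fun w => ?_⟩
    by_cases hwv : w = v
    · rw [hwv, hR.supportedOn.degN_addEdge_self hv, hv1]
      exact hd
    by_cases hwn : w = k + j
    · rw [hwn, hR.supportedOn.degN_addEdge_new hv]
      omega
    · rw [degN_addEdge_of_ne hv hwv hwn]
      exact hRd w

/-- A seed on at most as many vertices as `T`, not isomorphic to `T`, grows with positive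
probability into a tree of the size of `T` that is still not isomorphic to `T`. -/
theorem IsTreeOn.exists_not_iso {kS kT : ℕ} {S T : SimpleGraph ℕ} (hS : IsTreeOn kS S)
    (hkS : 3 ≤ kS) (hle : kS ≤ kT) (hST : IsEmpty (S ≃g T)) :
    ∃ R, IsTreeOn kT R ∧ PAlawAux kS S (kT - kS) {R} ≠ 0 ∧ IsEmpty (T ≃g R) := by
  obtain ⟨j, rfl⟩ := Nat.exists_eq_add_of_le hle
  rw [Nat.add_sub_cancel_left]
  rcases Nat.eq_zero_or_pos j with rfl | hj
  · exact ⟨S, hS, by rw [PAlawAux_zero_singleton]; exact one_ne_zero, ⟨fun e => hST.false e.symm⟩⟩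
  obtain ⟨v, hv, hmax⟩ := Finset.exists_max_image (Finset.range kS) (degN S)
    ⟨0, Finset.mem_range.2 (by omega)⟩
  have hv := Finset.mem_range.1 hv
  obtain ⟨w, hw, hw2⟩ := hS.exists_two_le_degN hkS
  have hv2 : 2 ≤ degN S v := hw2.trans (hmax w (Finset.mem_range.2 hw))
  have hdeg : ∀ u, degN S u ≤ degN S v := by
    intro u
    rcases lt_or_ge u kS with hu | hu
    · exact hmax u (Finset.mem_range.2 hu)
    · rw [hS.supportedOn.degN_eq_zero hu]
      exact Nat.zero_le _
  obtain ⟨R₁, hR₁, hm₁, hd₁⟩ := hS.exists_large_degN hv (by omega) j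
  obtain ⟨R₂, hR₂, hm₂, hd₂⟩ := hS.exists_bounded_degN (by omega) hv2 hdeg j
  by_cases h₁ : IsEmpty (T ≃g R₁)
  · exact ⟨R₁, hR₁, hm₁, h₁⟩
  refine ⟨R₂, hR₂, hm₂, ⟨fun e₂ => ?_⟩⟩
  obtain ⟨e₁⟩ := not_isEmpty_iff.1 h₁
  have := degN_eq_of_iso (e₁.symm.trans e₂) v
  have := hd₂ ((e₁.symm.trans e₂) v)
  omega

theorem smul_PAlaw_le {kS kT n : ℕ} {S R : SimpleGraph ℕ} (hle : kS ≤ kT) (hn : kT ≤ n) :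
    (PAlawAux kS S (kT - kS) {R}) • PAlaw kT R n ≤ PAlaw kS S n := by
  have h := smul_PAlawAux_le (k := kS) (j := kT - kS) (S := S) (R := R) (n - kT)
  have h1 : kS + (kT - kS) = kT := by omega
  have h2 : kT - kS + (n - kT) = n - kS := by omega
  rwa [h1, h2] at h

theorem bddAbove_tvDist {α : Type*} [MeasurableSpace α] (μ ν : Measure α)
    [IsProbabilityMeasure μ] [IsProbabilityMeasure ν] :
    BddAbove (Set.range fun A : Set α => |(μ A).toReal - (ν A).toReal|) := by
  refine ⟨1, ?_⟩
  rintro _ ⟨A, rfl⟩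
  have h1 : (μ A).toReal ≤ 1 := measureReal_le_one
  have h2 : (ν A).toReal ≤ 1 := measureReal_le_one
  have h3 : 0 ≤ (μ A).toReal := ENNReal.toReal_nonneg
  have h4 : 0 ≤ (ν A).toReal := ENNReal.toReal_nonneg
  exact abs_le.2 ⟨by linarith, by linarith⟩

theorem tvDist_le_one {α : Type*} [MeasurableSpace α] (μ ν : Measure α)
    [IsProbabilityMeasure μ] [IsProbabilityMeasure ν] : tvDist μ ν ≤ 1 := by
  refine ciSup_le fun A => ?_
  have h1 : (μ A).toReal ≤ 1 := measureReal_le_one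
  have h2 : (ν A).toReal ≤ 1 := measureReal_le_one
  have h3 : 0 ≤ (μ A).toReal := ENNReal.toReal_nonneg
  have h4 : 0 ≤ (ν A).toReal := ENNReal.toReal_nonneg
  exact abs_le.2 ⟨by linarith, by linarith⟩

theorem tvDist_comm {α : Type*} [MeasurableSpace α] (μ ν : Measure α) :
    tvDist μ ν = tvDist ν μ := by
  simp only [tvDist, abs_sub_comm]

theorem deltaPA_comm (kS : ℕ) (S : SimpleGraph ℕ) (kT : ℕ) (T : SimpleGraph ℕ) :
    deltaPA kS S kT T = deltaPA kT T kS S := by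
  simp only [deltaPA, tvDist_comm]

theorem PAtype_apply (k : ℕ) (T : SimpleGraph ℕ) (n : ℕ) (A : Set GraphType) :
    PAtype k T n A = PAlaw k T n (Quotient.mk graphSetoid ⁻¹' A) :=
  Measure.map_apply Measurable.of_discrete MeasurableSet.of_discrete

/-- An isomorphism-invariant event separates the laws of the isomorphism types at least as much as
it separates the laws of the labelled trees. -/
theorem sub_le_tvDist_PAtype {kS kT : ℕ} {S T : SimpleGraph ℕ} (hS : IsTreeOn kS S)
    (hT : IsTreeOn kT T) (hkS : 2 ≤ kS) (hkT : 2 ≤ kT) (n k : ℕ) (U : SimpleGraph ℕ) (x : ℝ) :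
    (PAlaw kS S n {G | x < (UmaxDeg k U G : ℝ)}).toReal -
      (PAlaw kT T n {G | x < (UmaxDeg k U G : ℝ)}).toReal ≤
      tvDist (PAtype kS S n) (PAtype kT T n) := by
  have := hS.isProbabilityMeasure_PAtype hkS n
  have := hT.isProbabilityMeasure_PAtype hkT n
  let A : Set GraphType := Quotient.mk graphSetoid '' {G | x < (UmaxDeg k U G : ℝ)}
  have hA : Quotient.mk graphSetoid ⁻¹' A = {G | x < (UmaxDeg k U G : ℝ)} := by
    ext G
    constructor
    · rintro ⟨H, hH, hHG⟩
      obtain ⟨e⟩ : Nonempty (H ≃g G) := Quotient.exact hHG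
      rw [Set.mem_ofPred_eq, ← UmaxDeg_eq_of_iso e]
      exact hH
    · exact fun hG => ⟨G, hG, rfl⟩
  have h := le_ciSup (bddAbove_tvDist (PAtype kS S n) (PAtype kT T n)) A
  refine le_trans ?_ h
  rw [PAtype_apply, PAtype_apply, hA]
  exact le_abs_self _

/-- The limit of the `2s`-th moment of `seedDeg (N + 1) G / √n` for a preferential attachment tree
grown from a seed on `N + 1` vertices. -/
def seedMoment (N s : ℕ) : ℝ := ((2 * N).ascFactorial (2 * s) : ℝ) / (N.ascFactorial s : ℝ)

theorem ascFactorial_pos_of_pos {N : ℕ} (hN : N ≠ 0) (s : ℕ) : 0 < N.ascFactorial s := by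
  have := Nat.pow_succ_le_ascFactorial N s
  have := Nat.pow_pos (n := s) (Nat.pos_of_ne_zero hN)
  omega

theorem factorial_le_seedMoment {N : ℕ} (hN : N ≠ 0) (s : ℕ) :
    (s.factorial : ℝ) ≤ seedMoment N s := by
  have hpos : (0 : ℝ) < N.ascFactorial s := by exact_mod_cast ascFactorial_pos_of_pos hN s
  rw [seedMoment, le_div_iff₀ hpos]
  have h : s.factorial * N.ascFactorial s ≤ (2 * N).ascFactorial (2 * s) := by
    rw [two_mul s, ← Nat.ascFactorial_mul_ascFactorial, mul_comm, ← Nat.one_ascFactorial]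
    exact Nat.mul_le_mul (Nat.ascFactorial_le _ (by omega)) (Nat.ascFactorial_le _ (by omega))
  exact_mod_cast h

theorem seedMoment_pos {N : ℕ} (hN : N ≠ 0) (s : ℕ) : 0 < seedMoment N s :=
  (Nat.cast_pos.2 s.factorial_pos).trans_le (factorial_le_seedMoment hN s)

theorem seedMoment_mul_Gamma {N : ℕ} (hN : N ≠ 0) (s : ℕ) :
    seedMoment N s * Real.Gamma (N + 1 / 2) = 4 ^ s * Real.Gamma (N + s + 1 / 2) := by
  induction s with
  | zero => simp [seedMoment]
  | succ s ih =>
    have hpos : (0 : ℝ) < N.ascFactorial s := by exact_mod_cast ascFactorial_pos_of_pos hN s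
    have hNs : (0 : ℝ) < N + s := by
      have : 0 < N + s := by omega
      exact_mod_cast this
    have hstep : seedMoment N (s + 1) = 4 * (N + s + 1 / 2) * seedMoment N s := by
      rw [seedMoment, seedMoment, mul_add, mul_one, Nat.ascFactorial_succ, Nat.ascFactorial_succ,
        Nat.ascFactorial_succ]
      push_cast
      field_simp
      ring
    have hG : Real.Gamma (N + (s + 1 : ℕ) + 1 / 2) =
        (N + s + 1 / 2) * Real.Gamma (N + s + 1 / 2) := by
      rw [← Real.Gamma_add_one (by positivity)]
      congr 1
      push_cast
      ring
    rw [hstep, hG, mul_assoc, ih]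
    ring

theorem IsTreeOn.lintegral_ascFactorial_eq {N : ℕ} {T : SimpleGraph ℕ}
    (hT : IsTreeOn (N + 1) T) (hN : N ≠ 0) (s m : ℕ) :
    ∫⁻ G, ((_root_.seedDeg (N + 1) G).ascFactorial (2 * s) : ℝ≥0∞) ∂(PAlawAux (N + 1) T m) =
      ENNReal.ofReal (seedMoment N s * ((N + m).ascFactorial s : ℝ)) := by
  have hpos := ascFactorial_pos_of_pos hN s
  have hpos' : (0 : ℝ) < N.ascFactorial s := by exact_mod_cast hpos
  have h := hT.lintegral_ascFactorial hN s m
  rw [← ENNReal.mul_left_inj (c := (N.ascFactorial s : ℝ≥0∞)) (by exact_mod_cast hpos.ne')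
    (ENNReal.natCast_ne_top _), h, ← ENNReal.ofReal_natCast (N.ascFactorial s),
    ← ENNReal.ofReal_mul' (by positivity), ← ENNReal.ofReal_natCast, ← ENNReal.ofReal_natCast,
    ← ENNReal.ofReal_mul (by positivity), seedMoment]
  congr 1
  field_simp

theorem div_sqrt_pow_two_mul (x : ℝ) (n s : ℕ) :
    (x / √(n : ℝ)) ^ (2 * s) = ((n : ℝ) ^ s)⁻¹ * x ^ (2 * s) := by
  rw [div_pow, pow_mul (√(n : ℝ)), Real.sq_sqrt (Nat.cast_nonneg n), div_eq_inv_mul]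

theorem IsTreeOn.lintegral_rescaled_le {N n : ℕ} {T : SimpleGraph ℕ}
    (hT : IsTreeOn (N + 1) T) (hN : N ≠ 0) (hn : N + 1 ≤ n) (s : ℕ) :
    ∫⁻ G, ENNReal.ofReal ((_root_.seedDeg (N + 1) G / √(n : ℝ)) ^ (2 * s))
        ∂(PAlaw (N + 1) T n) ≤ ENNReal.ofReal (seedMoment N s * s.factorial) := by
  have hn0 : (0 : ℝ) < n := by
    have : 0 < n := by omega
    exact_mod_cast this
  calc ∫⁻ G, ENNReal.ofReal ((_root_.seedDeg (N + 1) G / √(n : ℝ)) ^ (2 * s)) ∂(PAlaw (N + 1) T n)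
      ≤ ∫⁻ G, ENNReal.ofReal ((n : ℝ) ^ s)⁻¹ *
          ((_root_.seedDeg (N + 1) G).ascFactorial (2 * s) : ℝ≥0∞) ∂(PAlaw (N + 1) T n) := by
        refine lintegral_mono fun G => ?_
        rw [div_sqrt_pow_two_mul, ENNReal.ofReal_mul (by positivity),
          ← Nat.cast_pow (_root_.seedDeg (N + 1) G), ENNReal.ofReal_natCast]
        gcongr
        exact Nat.pow_succ_le_ascFactorial _ _
    _ = ENNReal.ofReal (((n : ℝ) ^ s)⁻¹ *
          (seedMoment N s * ((N + (n - (N + 1))).ascFactorial s : ℝ))) := by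
        rw [lintegral_const_mul _ Measurable.of_discrete, PAlaw,
          hT.lintegral_ascFactorial_eq hN,
          ENNReal.ofReal_mul (p := ((n : ℝ) ^ s)⁻¹) (by positivity)]
    _ ≤ ENNReal.ofReal (seedMoment N s * s.factorial) := by
        refine ENNReal.ofReal_le_ofReal ?_
        have h1 : (N + (n - (N + 1))).ascFactorial s ≤ s.factorial * n ^ s :=
          (Nat.ascFactorial_le_factorial_mul_pow _ _).trans
            (Nat.mul_le_mul_left _ (Nat.pow_le_pow_left (by omega) _))
        have h2 : ((N + (n - (N + 1))).ascFactorial s : ℝ) ≤ s.factorial * (n : ℝ) ^ s := by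
          exact_mod_cast h1
        rw [inv_mul_le_iff₀ (by positivity)]
        have := mul_le_mul_of_nonneg_left h2 (seedMoment_pos hN s).le
        linarith

theorem ascFactorial_two_mul_le (s d : ℕ) :
    ((d.ascFactorial (2 * s) : ℕ) : ℝ) ≤
      3 * (d : ℝ) ^ (2 * s) + ((4 * s * s + 2 * s : ℕ) : ℝ) ^ (2 * s) := by
  have h1 : d.ascFactorial (2 * s) ≤ (d + 2 * s) ^ (2 * s) :=
    (Nat.ascFactorial_le _ (Nat.le_succ d)).trans (Nat.ascFactorial_le_pow_add d (2 * s))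
  have h1 : ((d.ascFactorial (2 * s) : ℕ) : ℝ) ≤ ((d + 2 * s : ℕ) : ℝ) ^ (2 * s) := by
    exact_mod_cast h1
  rcases le_total d (4 * s * s) with h | h
  · have : ((d + 2 * s : ℕ) : ℝ) ^ (2 * s) ≤ ((4 * s * s + 2 * s : ℕ) : ℝ) ^ (2 * s) := by
      gcongr
    have : (0 : ℝ) ≤ 3 * (d : ℝ) ^ (2 * s) := by positivity
    linarith
  · rcases Nat.eq_zero_or_pos s with rfl | hs
    · norm_num
    have hs' : (0 : ℝ) < s := by exact_mod_cast hs
    have hd : (4 : ℝ) * s * s ≤ d := by exact_mod_cast h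
    have h2 : ((d + 2 * s : ℕ) : ℝ) ≤ d * Real.exp (1 / (2 * s)) := by
      have h3 := Real.add_one_le_exp (1 / (2 * s : ℝ))
      have h4 : (2 * s : ℝ) ≤ d * (1 / (2 * s)) := by
        rw [mul_one_div, le_div_iff₀ (by positivity)]
        linarith
      push_cast
      nlinarith
    have h5 : ((d + 2 * s : ℕ) : ℝ) ^ (2 * s) ≤ (d * Real.exp (1 / (2 * s))) ^ (2 * s) := by
      gcongr
    have h6 : (Real.exp (1 / (2 * s))) ^ (2 * s) = Real.exp 1 := by
      rw [← Real.exp_nat_mul]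
      congr 1
      push_cast
      field_simp
    rw [mul_pow, h6] at h5
    have h7 := Real.exp_one_lt_three
    have h8 : (d : ℝ) ^ (2 * s) * Real.exp 1 ≤ (d : ℝ) ^ (2 * s) * 3 := by gcongr
    have h9 : (0 : ℝ) ≤ ((4 * s * s + 2 * s : ℕ) : ℝ) ^ (2 * s) := by positivity
    linarith

theorem eventually_quarter_lt_pow {a c : ℝ} (ha : 0 < a) {s : ℕ} (hs : s ≠ 0) :
    ∀ᶠ n : ℕ in atTop, a * (n : ℝ) ^ s / 4 + c < a * ((n : ℝ) - 1) ^ s := by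
  filter_upwards [eventually_ge_atTop (2 * s + 1),
    (tendsto_natCast_atTop_atTop (R := ℝ)).eventually_gt_atTop (4 * c / a)] with n hn hnc
  have hn1 : (1 : ℝ) ≤ n := by
    have : 1 ≤ n := by omega
    exact_mod_cast this
  have hn2 : (2 * s : ℝ) ≤ n := by
    have : 2 * s ≤ n := by omega
    exact_mod_cast this
  have h1 : (1 : ℝ) / 2 ≤ (1 + -(1 / n)) ^ s := by
    have hb := one_add_mul_le_pow (a := -(1 / (n : ℝ)))
      (by have : 1 / (n : ℝ) ≤ 1 := by rw [div_le_one (by linarith)]; exact hn1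
          linarith) s
    have : (s : ℝ) * (1 / n) ≤ 1 / 2 := by
      rw [mul_one_div, div_le_iff₀ (by linarith)]
      linarith
    linarith
  have h2 : ((n : ℝ) - 1) ^ s = (n : ℝ) ^ s * (1 + -(1 / n)) ^ s := by
    rw [← mul_pow]
    congr 1
    field_simp
    ring
  have h3 : (n : ℝ) ≤ (n : ℝ) ^ s := le_self_pow₀ hn1 hs
  rw [div_lt_iff₀ ha] at hnc
  have h4 : (n : ℝ) ^ s * (1 / 2) ≤ ((n : ℝ) - 1) ^ s := by
    rw [h2]
    gcongr
  have h5 := mul_le_mul_of_nonneg_left h4 ha.le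
  have h6 := mul_le_mul_of_nonneg_left h3 ha.le
  linarith

theorem IsTreeOn.eventually_le_lintegral_rescaled {N : ℕ} {T : SimpleGraph ℕ}
    (hT : IsTreeOn (N + 1) T) (hN : N ≠ 0) {s : ℕ} (hs : s ≠ 0) :
    ∀ᶠ n : ℕ in atTop, ENNReal.ofReal (seedMoment N s / 12) ≤
      ∫⁻ G, ENNReal.ofReal ((_root_.seedDeg (N + 1) G / √(n : ℝ)) ^ (2 * s))
        ∂(PAlaw (N + 1) T n) := by
  set C : ℝ := ((4 * s * s + 2 * s : ℕ) : ℝ) ^ (2 * s) with hC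
  have hC0 : 0 ≤ C := by positivity
  have hA := seedMoment_pos hN s
  filter_upwards [eventually_ge_atTop (N + 1), eventually_quarter_lt_pow (c := C) hA hs]
    with n hn hlt
  have := hT.isProbabilityMeasure_PAlaw (by omega) n
  have hn0 : (0 : ℝ) < n := by
    have : 0 < n := by omega
    exact_mod_cast this
  by_contra! hcon
  have hE := hT.lintegral_ascFactorial_eq hN s (n - (N + 1))
  have hup : ENNReal.ofReal (seedMoment N s * ((N + (n - (N + 1))).ascFactorial s : ℝ)) ≤
      ENNReal.ofReal (3 * (n : ℝ) ^ s) * ENNReal.ofReal (seedMoment N s / 12) +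
        ENNReal.ofReal C := by
    rw [← hE]
    calc _ ≤ ∫⁻ G, (ENNReal.ofReal (3 * (n : ℝ) ^ s) *
          ENNReal.ofReal ((_root_.seedDeg (N + 1) G / √(n : ℝ)) ^ (2 * s)) + ENNReal.ofReal C)
            ∂(PAlaw (N + 1) T n) := by
          rw [PAlaw]
          refine lintegral_mono fun G => ?_
          rw [← ENNReal.ofReal_mul (by positivity), ← ENNReal.ofReal_add (by positivity) hC0,
            ← ENNReal.ofReal_natCast]
          refine ENNReal.ofReal_le_ofReal
            ((ascFactorial_two_mul_le s (_root_.seedDeg (N + 1) G)).trans_eq ?_)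
          rw [div_sqrt_pow_two_mul, ← hC]
          field_simp
      _ ≤ _ := by
          rw [lintegral_add_right _ measurable_const,
            lintegral_const_mul _ Measurable.of_discrete, lintegral_const, measure_univ, mul_one]
          gcongr
  rw [← ENNReal.ofReal_mul (by positivity), ← ENNReal.ofReal_add (by positivity) hC0,
    ENNReal.ofReal_le_ofReal_iff (by positivity)] at hup
  have h1 : (n - 1) ^ s ≤ (N + (n - (N + 1))).ascFactorial s := by
    have hidx : N + (n - (N + 1)) = n - 1 := by omega
    rw [hidx]
    exact Nat.pow_succ_le_ascFactorial _ _
  have h2 : ((n : ℝ) - 1) ^ s ≤ ((N + (n - (N + 1))).ascFactorial s : ℝ) := by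
    have h3 : ((n - 1 : ℕ) : ℝ) = (n : ℝ) - 1 := by
      rw [Nat.cast_sub (by omega), Nat.cast_one]
    rw [← h3]
    exact_mod_cast h1
  have h4 := mul_le_mul_of_nonneg_left h2 hA.le
  have h5 : 3 * (n : ℝ) ^ s * (seedMoment N s / 12) = seedMoment N s * (n : ℝ) ^ s / 4 := by ring
  linarith

theorem lintegral_tail_dominator_ne_top (K : ℝ) :
    ∫⁻ t in Set.Ioi (0 : ℝ), ((Set.Ioc 0 1).indicator 1 t +
      (Set.Ioi 1).indicator (fun t : ℝ => ENNReal.ofReal (K * t ^ (-3 : ℝ))) t) ≠ ⊤ := by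
  have hint : IntegrableOn (fun t : ℝ => K * t ^ (-3 : ℝ)) (Set.Ioi 1) :=
    (integrableOn_Ioi_rpow_of_lt (by norm_num) one_pos).const_mul K
  rw [lintegral_add_left (measurable_one.indicator measurableSet_Ioc),
    ENNReal.add_ne_top]
  constructor
  · refine ne_top_of_le_ne_top ?_ (lintegral_mono' Measure.restrict_le_self le_rfl)
    rw [lintegral_indicator_one measurableSet_Ioc, Real.volume_Ioc]
    exact ENNReal.ofReal_ne_top
  · refine ne_top_of_le_ne_top ?_ (lintegral_mono' Measure.restrict_le_self le_rfl)
    rw [lintegral_indicator measurableSet_Ioi]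
    exact hint.lintegral_lt_top.ne

theorem IsTreeOn.meas_mul_rpow_le {N n : ℕ} {T : SimpleGraph ℕ}
    (hT : IsTreeOn (N + 1) T) (hN : N ≠ 0) (hn : N + 1 ≤ n) {s : ℕ} (hs : s ≠ 0)
    {t : ℝ} (ht : 0 < t) :
    PAlaw (N + 1) T n {G | t < _root_.seedDeg (N + 1) G / √(n : ℝ)} *
        ENNReal.ofReal (t ^ (((2 * s : ℕ) : ℝ) - 1)) ≤
      (Set.Ioc 0 1).indicator 1 t + (Set.Ioi 1).indicator (fun t : ℝ => ENNReal.ofReal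
        (seedMoment N (s + 1) * (s + 1).factorial * t ^ (-3 : ℝ))) t := by
  have := hT.isProbabilityMeasure_PAlaw (by omega) n
  have hs1 : (1 : ℝ) ≤ ((2 * s : ℕ) : ℝ) := by
    have : 1 ≤ 2 * s := by omega
    exact_mod_cast this
  rcases le_or_gt t 1 with h1 | h1
  · rw [Set.indicator_of_mem (show t ∈ Set.Ioc 0 1 from ⟨ht, h1⟩), Pi.one_apply]
    refine le_add_right ?_
    refine mul_le_one' prob_le_one ?_
    rw [ENNReal.ofReal_le_one]
    exact Real.rpow_le_one ht.le h1 (by linarith)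
  · rw [Set.indicator_of_mem (show t ∈ Set.Ioi 1 from h1)]
    refine le_add_left ?_
    have hmarkov : PAlaw (N + 1) T n {G | t < _root_.seedDeg (N + 1) G / √(n : ℝ)} ≤
        ENNReal.ofReal (seedMoment N (s + 1) * (s + 1).factorial) /
          ENNReal.ofReal (t ^ (2 * (s + 1))) := by
      refine le_trans (measure_mono fun G hG => ?_) ((meas_ge_le_lintegral_div
        (ε := ENNReal.ofReal (t ^ (2 * (s + 1))))
        (f := fun G => ENNReal.ofReal ((_root_.seedDeg (N + 1) G / √(n : ℝ)) ^ (2 * (s + 1))))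
        Measurable.of_discrete.aemeasurable (ENNReal.ofReal_pos.2 (by positivity)).ne'
        ENNReal.ofReal_ne_top).trans ?_)
      · exact ENNReal.ofReal_le_ofReal (pow_le_pow_left₀ ht.le (le_of_lt hG) _)
      · gcongr
        exact hT.lintegral_rescaled_le hN hn (s + 1)
    have hA := seedMoment_pos hN (s + 1)
    refine (mul_le_mul_left hmarkov _).trans_eq ?_
    rw [← ENNReal.ofReal_div_of_pos (by positivity), ← ENNReal.ofReal_mul (by positivity)]
    congr 1
    rw [← Real.rpow_natCast, div_eq_mul_inv, ← Real.rpow_neg ht.le, mul_assoc, ← Real.rpow_add ht]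
    congr 2
    push_cast
    ring

/-- The limiting moments of the rescaled seed degree are bounded by the moments of its limiting
tail. -/
theorem IsTreeOn.seedMoment_le_lintegral_limsup {N : ℕ} {T : SimpleGraph ℕ}
    (hT : IsTreeOn (N + 1) T) (hN : N ≠ 0) {s : ℕ} (hs : s ≠ 0) :
    ENNReal.ofReal (seedMoment N s / 12) ≤ ENNReal.ofReal ((2 * s : ℕ) : ℝ) *
      ∫⁻ t in Set.Ioi (0 : ℝ), limsup (fun n : ℕ =>
        PAlaw (N + 1) T n {G | t * √(n : ℝ) < _root_.seedDeg (N + 1) G}) atTop *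
          ENNReal.ofReal (t ^ (((2 * s : ℕ) : ℝ) - 1)) := by
  have hp : (0 : ℝ) < ((2 * s : ℕ) : ℝ) := by
    have : 0 < 2 * s := by omega
    exact_mod_cast this
  set F : ℕ → ℝ → ℝ≥0∞ := fun n t =>
    PAlaw (N + 1) T n {G | t < _root_.seedDeg (N + 1) G / √(n : ℝ)} *
      ENNReal.ofReal (t ^ (((2 * s : ℕ) : ℝ) - 1)) with hF
  have hlayer : ∀ n : ℕ, ∫⁻ G, ENNReal.ofReal
      ((_root_.seedDeg (N + 1) G / √(n : ℝ)) ^ (2 * s)) ∂(PAlaw (N + 1) T n) =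
      ENNReal.ofReal ((2 * s : ℕ) : ℝ) * ∫⁻ t in Set.Ioi (0 : ℝ), F n t := by
    intro n
    rw [hF, ← lintegral_rpow_eq_lintegral_meas_lt_mul _
      (Eventually.of_forall fun G => by positivity) Measurable.of_discrete.aemeasurable hp]
    simp only [Real.rpow_natCast]
  have hmeas : ∀ n, Measurable (F n) := by
    intro n
    refine Measurable.mul (Antitone.measurable fun t u htu => ?_)
      (ENNReal.measurable_ofReal.comp (measurable_id.pow_const _))
    exact measure_mono fun G hG => lt_of_le_of_lt htu hG
  have hfatou := limsup_lintegral_le (μ := volume.restrict (Set.Ioi (0 : ℝ)))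
    (f := fun n => F (n + (N + 1))) _ (fun n => hmeas _)
    (fun n => (ae_restrict_iff' measurableSet_Ioi).2 (Eventually.of_forall fun t ht =>
      hT.meas_mul_rpow_le hN (Nat.le_add_left _ n) hs ht))
    (lintegral_tail_dominator_ne_top _)
  have hlim : ENNReal.ofReal (seedMoment N s / 12) ≤ ENNReal.ofReal ((2 * s : ℕ) : ℝ) *
      limsup (fun n => ∫⁻ t in Set.Ioi (0 : ℝ), F (n + (N + 1)) t) atTop := by
    rw [← ENNReal.limsup_const_mul_of_ne_top ENNReal.ofReal_ne_top]
    refine le_limsup_of_frequently_le (Eventually.frequently ?_)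
    filter_upwards [(tendsto_add_atTop_nat (N + 1)).eventually
      (hT.eventually_le_lintegral_rescaled hN hs)] with n hn
    rwa [hlayer] at hn
  refine hlim.trans (mul_le_mul_right (hfatou.trans_eq ?_) _)
  refine lintegral_congr fun t => ?_
  rw [hF, ENNReal.limsup_mul_const_of_ne_top ENNReal.ofReal_ne_top, mul_comm]
  congr 1
  rw [← Filter.limsup_nat_add (fun n : ℕ =>
    PAlaw (N + 1) T n {G | t * √(n : ℝ) < _root_.seedDeg (N + 1) G}) (N + 1)]
  refine congrArg (fun u : ℕ → ℝ≥0∞ => limsup u atTop) (funext fun n => ?_)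
  have hpos : 0 < √((n + (N + 1) : ℕ) : ℝ) := Real.sqrt_pos.2 (by positivity)
  simp only [lt_div_iff₀ hpos]

theorem two_mul_mul_integral_le_seedMoment {N s : ℕ} (hN : N ≠ 0) :
    ((2 * s : ℕ) : ℝ) * ∫ t in Set.Ioi (0 : ℝ),
        t ^ (2 * (N : ℝ) + 2 * s - 2) * Real.exp (-(1 / 4) * t ^ (2 : ℝ)) ≤
      4 ^ N / 2 * Real.Gamma (N + 1 / 2) * seedMoment N s := by
  have hN1 : (1 : ℝ) ≤ N := by exact_mod_cast Nat.one_le_iff_ne_zero.2 hN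
  have hs0 : (0 : ℝ) ≤ s := Nat.cast_nonneg s
  have hx : 0 < (N : ℝ) + s - 1 / 2 := by linarith
  have hpow : ((1 / 4 : ℝ)) ^ (-((2 * (N : ℝ) + 2 * s - 2) + 1) / 2) = 4 ^ N * 4 ^ s / 2 := by
    have h1 : -((2 * (N : ℝ) + 2 * s - 2) + 1) / 2 = -(((N + s : ℕ) : ℝ) - 1 / 2) := by
      push_cast
      ring
    have h2 : (4 : ℝ) ^ (1 / 2 : ℝ) = 2 := by
      rw [← Real.sqrt_eq_rpow, show (4 : ℝ) = 2 ^ 2 by norm_num]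
      exact Real.sqrt_sq (by norm_num)
    rw [h1, one_div, Real.inv_rpow (by norm_num), ← Real.rpow_neg (by norm_num), neg_neg,
      Real.rpow_sub (by norm_num), Real.rpow_natCast, pow_add, one_div (2 : ℝ), ← one_div, h2]
  have hG : Real.Gamma (N + s + 1 / 2) = (N + s - 1 / 2) * Real.Gamma (N + s - 1 / 2) := by
    rw [← Real.Gamma_add_one hx.ne']
    congr 1
    ring
  have hGpos : 0 < Real.Gamma ((N : ℝ) + s - 1 / 2) := Real.Gamma_pos_of_pos hx
  have harg : ((2 * (N : ℝ) + 2 * s - 2) + 1) / 2 = N + s - 1 / 2 := by ring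
  rw [integral_rpow_mul_exp_neg_mul_rpow (by norm_num) (by linarith) (by norm_num), hpow, harg]
  have hA := seedMoment_mul_Gamma hN s
  rw [hG] at hA
  have hrhs : 4 ^ N / 2 * Real.Gamma (N + 1 / 2) * seedMoment N s =
      4 ^ N / 2 * (4 ^ s * ((N + s - 1 / 2) * Real.Gamma (N + s - 1 / 2))) := by
    rw [← hA]
    ring
  rw [hrhs]
  have hle : (s : ℝ) ≤ N + s - 1 / 2 := by linarith
  have hc : (0 : ℝ) ≤ 4 ^ N / 2 * 4 ^ s * Real.Gamma (N + s - 1 / 2) := by positivity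
  have := mul_le_mul_of_nonneg_left hle hc
  push_cast
  linarith

theorem exists_mul_pow_lt_factorial (c : ℝ) : ∃ s : ℕ, s ≠ 0 ∧ 24 * c ^ s < s.factorial := by
  have h := (FloorSemiring.tendsto_pow_div_factorial_atTop c).eventually_lt_const
    (show (0 : ℝ) < 1 / 24 by norm_num)
  obtain ⟨s, hs, hs0⟩ := (h.and (eventually_ne_atTop 0)).exists
  have hpos : (0 : ℝ) < s.factorial := Nat.cast_pos.2 s.factorial_pos
  rw [div_lt_iff₀ hpos] at hs
  exact ⟨s, hs0, by linarith⟩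

/-- The tail of the rescaled total degree of a seed on `k` vertices is not
`o(t ^ (2k - 3) * exp (-t² / 4))`. -/
theorem IsTreeOn.exists_lt_limsup {N : ℕ} {T : SimpleGraph ℕ}
    (hT : IsTreeOn (N + 1) T) (hN : N ≠ 0) :
    ∃ ε > (0 : ℝ), ∀ t₀ > (0 : ℝ), ∃ t ≥ t₀,
      ENNReal.ofReal (ε * (t ^ (2 * ((N + 1 : ℕ) : ℝ) - 3) * Real.exp (-t ^ 2 / 4))) <
        limsup (fun n : ℕ =>
          PAlaw (N + 1) T n {G | t * √(n : ℝ) < _root_.seedDeg (N + 1) G}) atTop := by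
  have hN1 : (1 : ℝ) ≤ N := by exact_mod_cast Nat.one_le_iff_ne_zero.2 hN
  set K : ℝ := 4 ^ N / 2 * Real.Gamma (N + 1 / 2) with hK
  have hK0 : 0 < K := mul_pos (by positivity) (Real.Gamma_pos_of_pos (by linarith))
  refine ⟨1 / (24 * K), by positivity, fun t₀ ht₀ => ?_⟩
  by_contra! hcon
  obtain ⟨s, hs, hlt⟩ := exists_mul_pow_lt_factorial (4 * t₀ ^ 2)
  have hs0 : (0 : ℝ) ≤ s := Nat.cast_nonneg s
  have hp1 : (1 : ℝ) ≤ ((2 * s : ℕ) : ℝ) := by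
    have : 1 ≤ 2 * s := by omega
    exact_mod_cast this
  set J : ℝ := ∫ t in Set.Ioi (0 : ℝ),
    t ^ (2 * (N : ℝ) + 2 * s - 2) * Real.exp (-(1 / 4) * t ^ (2 : ℝ)) with hJ
  have hJint : IntegrableOn (fun t : ℝ =>
      t ^ (2 * (N : ℝ) + 2 * s - 2) * Real.exp (-(1 / 4) * t ^ (2 : ℝ))) (Set.Ioi 0) :=
    integrableOn_rpow_mul_exp_neg_mul_rpow (by linarith) (by norm_num) (by norm_num)
  have hJ0 : 0 ≤ J := setIntegral_nonneg measurableSet_Ioi fun t ht => by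
    have : (0 : ℝ) < t := ht
    positivity
  have hbound : ∫⁻ t in Set.Ioi (0 : ℝ), limsup (fun n : ℕ =>
        PAlaw (N + 1) T n {G | t * √(n : ℝ) < _root_.seedDeg (N + 1) G}) atTop *
          ENNReal.ofReal (t ^ (((2 * s : ℕ) : ℝ) - 1)) ≤
      ENNReal.ofReal (t₀ ^ (2 * s) + 1 / (24 * K) * J) := by
    calc _ ≤ ∫⁻ t in Set.Ioi (0 : ℝ), ((Set.Ioc 0 t₀).indicator
            (fun _ => ENNReal.ofReal (t₀ ^ (((2 * s : ℕ) : ℝ) - 1))) t +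
          ENNReal.ofReal (1 / (24 * K)) * ENNReal.ofReal
            (t ^ (2 * (N : ℝ) + 2 * s - 2) * Real.exp (-(1 / 4) * t ^ (2 : ℝ)))) := by
          refine setLIntegral_mono' measurableSet_Ioi fun t ht => ?_
          have ht : (0 : ℝ) < t := ht
          rcases le_or_gt t t₀ with h | h
          · rw [Set.indicator_of_mem (show t ∈ Set.Ioc 0 t₀ from ⟨ht, h⟩)]
            refine le_add_right ?_
            rw [← one_mul (ENNReal.ofReal (t₀ ^ _))]
            gcongr
            · refine limsup_le_of_le (h := Eventually.of_forall fun n => ?_)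
              have := hT.isProbabilityMeasure_PAlaw (by omega) n
              exact prob_le_one
          · refine le_add_left ?_
            refine (mul_le_mul_left (hcon t h.le) _).trans_eq ?_
            rw [← ENNReal.ofReal_mul (by positivity), ← ENNReal.ofReal_mul (by positivity)]
            congr 1
            have he : (2 * (N : ℝ) + 2 * s - 2) =
                (2 * ((N + 1 : ℕ) : ℝ) - 3) + (((2 * s : ℕ) : ℝ) - 1) := by
              push_cast
              ring
            rw [he, Real.rpow_add ht, Real.rpow_two,
              show -(1 / 4) * t ^ 2 = -t ^ 2 / 4 by ring]
            ring
      _ = (∫⁻ t in Set.Ioi (0 : ℝ), (Set.Ioc 0 t₀).indicator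
            (fun _ => ENNReal.ofReal (t₀ ^ (((2 * s : ℕ) : ℝ) - 1))) t) +
          ENNReal.ofReal (1 / (24 * K)) * ENNReal.ofReal J := by
          rw [lintegral_add_left (measurable_const.indicator measurableSet_Ioc),
            lintegral_const_mul' _ _ ENNReal.ofReal_ne_top, hJ,
            ofReal_integral_eq_lintegral_ofReal hJint]
          refine (ae_restrict_iff' measurableSet_Ioi).2 (Eventually.of_forall fun t ht => ?_)
          have : (0 : ℝ) < t := ht
          simp only [Pi.zero_apply]
          positivity
      _ ≤ ENNReal.ofReal (t₀ ^ (((2 * s : ℕ) : ℝ) - 1)) * ENNReal.ofReal t₀ +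
          ENNReal.ofReal (1 / (24 * K)) * ENNReal.ofReal J := by
          gcongr
          refine (lintegral_mono' Measure.restrict_le_self le_rfl).trans_eq ?_
          rw [lintegral_indicator measurableSet_Ioc, setLIntegral_const, Real.volume_Ioc, sub_zero]
      _ = _ := by
          rw [← ENNReal.ofReal_mul (by positivity), ← ENNReal.ofReal_mul (by positivity),
            ← ENNReal.ofReal_add (by positivity) (by positivity)]
          congr 2
          rw [← Real.rpow_natCast]
          nth_rewrite 2 [← Real.rpow_one t₀]
          rw [← Real.rpow_add ht₀]
          congr 1
          ring
  have hmain := (hT.seedMoment_le_lintegral_limsup hN hs).trans (mul_le_mul_right hbound _)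
  rw [← ENNReal.ofReal_mul (by positivity), ENNReal.ofReal_le_ofReal_iff (by positivity)] at hmain
  have hJle : ((2 * s : ℕ) : ℝ) * J ≤ K * seedMoment N s := two_mul_mul_integral_le_seedMoment hN
  have hKJ : 1 / (24 * K) * (((2 * s : ℕ) : ℝ) * J) ≤ seedMoment N s / 24 := by
    rw [one_div, inv_mul_le_iff₀ (by positivity)]
    linarith
  have hs4 : ((2 * s : ℕ) : ℝ) ≤ 4 ^ s := by
    have h1 : 2 * s < 2 ^ (2 * s) := Nat.lt_two_pow_self
    rw [pow_mul] at h1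
    exact_mod_cast h1.le
  have hpw : ((2 * s : ℕ) : ℝ) * t₀ ^ (2 * s) ≤ (4 * t₀ ^ 2) ^ s := by
    rw [mul_pow, ← pow_mul]
    gcongr
  have hfac := factorial_le_seedMoment hN s
  linarith

theorem IsTreeOn.PAlaw_seedDeg_le {k n : ℕ} {R : SimpleGraph ℕ} (hR : IsTreeOn k R) (x : ℝ) :
    PAlaw k R n {G | x < _root_.seedDeg k G} ≤ PAlaw k R n {G | x < (UmaxDeg k R G : ℝ)} := by
  refine measure_mono_ae ?_
  filter_upwards [hR.ae_PAlawAux (n - k)] with G hG hx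
  exact lt_of_lt_of_le hx (Nat.cast_le.2 (hG.1.supportedOn.seedDeg_le_UmaxDeg hG.2))

theorem IsTreeOn.eventually_tvDist_lt {kS kT : ℕ} {S T : SimpleGraph ℕ} (hS : IsTreeOn kS S)
    (hT : IsTreeOn kT T) (hkS : 2 ≤ kS) (hkT : 2 ≤ kT) {η : ℝ} (h : deltaPA kS S kT T < η) :
    ∀ᶠ n : ℕ in atTop, tvDist (PAtype kS S n) (PAtype kT T n) < η := by
  refine eventually_lt_of_limsup_lt h (isBoundedUnder_of ⟨1, fun n => ?_⟩)
  have := hS.isProbabilityMeasure_PAtype hkS n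
  have := hT.isProbabilityMeasure_PAtype hkT n
  exact tvDist_le_one _ _

open Asymptotics in
/-- If the tail of the `R`-maximum degree for the seed `T` is negligible, where `R` is a tree
reached from `S` with positive probability, then `S` and `T` are distinguished in the limit. -/
theorem IsTreeOn.deltaPA_pos_of_isLittleO {kS kT : ℕ} {S T R : SimpleGraph ℕ}
    (hS : IsTreeOn kS S) (hT : IsTreeOn kT T) (hR : IsTreeOn kT R) (hkS : 3 ≤ kS)
    (hle : kS ≤ kT) (hq : PAlawAux kS S (kT - kS) {R} ≠ 0)
    (ho : (fun t : ℝ => limsup (fun n : ℕ =>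
        ((PAlaw kT T n) {G | t * √(n : ℝ) < (UmaxDeg kT R G : ℝ)}).toReal) atTop)
      =o[atTop] (fun t : ℝ => t ^ (2 * (kT : ℝ) - 3) * Real.exp (-t ^ 2 / 4))) :
    0 < deltaPA kS S kT T := by
  by_contra! hδ
  set Q := PAlawAux kS S (kT - kS) {R} with hQ
  have hQtop : Q ≠ ⊤ := by
    have : PAlawAux kS S (kT - kS) = PAlaw kS S kT := rfl
    have := hS.isProbabilityMeasure_PAlaw (by omega) kT
    rw [hQ, ‹PAlawAux kS S (kT - kS) = PAlaw kS S kT›]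
    exact measure_ne_top _ _
  have hq0 : 0 < Q.toReal := ENNReal.toReal_pos hq hQtop
  obtain ⟨N, rfl⟩ : ∃ N, kT = N + 1 := ⟨kT - 1, by omega⟩
  obtain ⟨ε, hε, hlarge⟩ := hR.exists_lt_limsup (N := N) (by omega)
  obtain ⟨t₀, ht₀⟩ := eventually_atTop.1 (ho.bound (mul_pos hq0 hε))
  obtain ⟨t, ht, hlt⟩ := hlarge (max t₀ 1) (by positivity)
  have htpos : 0 < t := lt_of_lt_of_le (by positivity) ht
  set g : ℝ := t ^ (2 * ((N + 1 : ℕ) : ℝ) - 3) * Real.exp (-t ^ 2 / 4) with hg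
  have hg0 : 0 < g := by positivity
  have hup : limsup (fun n : ℕ => ((PAlaw (N + 1) T n)
      {G | t * √(n : ℝ) < (UmaxDeg (N + 1) R G : ℝ)}).toReal) atTop ≤ Q.toReal * ε * g := by
    have := ht₀ t ((le_max_left _ _).trans ht)
    rw [← hg, Real.norm_of_nonneg hg0.le] at this
    exact (Real.le_norm_self _).trans this
  refine hlt.not_ge (le_of_forall_gt_imp_ge_of_dense fun c hc => ?_)
  rcases eq_or_ne c ⊤ with rfl | hctop
  · exact le_top
  rw [ENNReal.ofReal_lt_iff_lt_toReal (by positivity) hctop] at hc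
  have hη : 0 < Q.toReal * (c.toReal - ε * g) / 2 := by
    have := sub_pos.2 hc
    positivity
  set η := Q.toReal * (c.toReal - ε * g) / 2 with hηdef
  have hT1 := eventually_lt_of_limsup_lt (lt_of_le_of_lt hup (lt_add_of_pos_right _ hη))
    (isBoundedUnder_of ⟨1, fun n => by
      have := hT.isProbabilityMeasure_PAlaw (by omega) n
      exact measureReal_le_one⟩)
  refine limsup_le_of_le (h := ?_)
  filter_upwards [hT1, hS.eventually_tvDist_lt hT (by omega) (by omega) (hδ.trans_lt hη),
    eventually_ge_atTop (N + 1)] with n h1 h2 h3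
  have := hS.isProbabilityMeasure_PAlaw (by omega) n
  have := hR.isProbabilityMeasure_PAlaw (by omega) n
  refine (hR.PAlaw_seedDeg_le _).trans ?_
  rw [← ENNReal.toReal_le_toReal (measure_ne_top _ _) hctop]
  have h4 := sub_le_tvDist_PAtype hS hT (by omega) (by omega) n (N + 1) R (t * √(n : ℝ))
  have h5 := ENNReal.toReal_mono (measure_ne_top _ _)
    (smul_PAlaw_le (S := S) (R := R) hle h3 {G | t * √(n : ℝ) < (UmaxDeg (N + 1) R G : ℝ)})
  rw [Measure.smul_apply, smul_eq_mul, ENNReal.toReal_mul] at h5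
  refine le_of_mul_le_mul_left ?_ hq0
  linarith

open Asymptotics in
/-- If for every pair of non-isomorphic seed trees `S, T` of the same size `k ≥ 3` one has
`limsup_n P(Δ_T(PA(n,S)) > t√n) = o(t^(2k-3) exp(-t²/4))` as `t → ∞`, then `δ(S,T) > 0`
for every pair of non-isomorphic seed trees on at least 3 vertices, i.e. `δ` is a metric
on isomorphism types of trees with at least 3 vertices. -/
theorem delta_pos_of_technical_conjecture
    (hyp : ∀ k : ℕ, 3 ≤ k → ∀ S T : SimpleGraph ℕ, IsTreeOn k S → IsTreeOn k T →
      IsEmpty (S ≃g T) →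
      (fun t : ℝ => Filter.limsup
          (fun n : ℕ => ((PAlaw k S n) {G | t * Real.sqrt n < (UmaxDeg k T G : ℝ)}).toReal)
          Filter.atTop)
        =o[Filter.atTop]
        (fun t : ℝ => t ^ (2 * (k : ℝ) - 3) * Real.exp (-t ^ 2 / 4))) :
    ∀ kS kT : ℕ, 3 ≤ kS → 3 ≤ kT → ∀ S T : SimpleGraph ℕ,
      IsTreeOn kS S → IsTreeOn kT T → IsEmpty (S ≃g T) →
      0 < deltaPA kS S kT T := by
  intro kS kT hkS hkT S T hS hT hST
  rcases le_total kS kT with hle | hle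
  · obtain ⟨R, hR, hq, hTR⟩ := hS.exists_not_iso hkS hle hST
    exact hS.deltaPA_pos_of_isLittleO hT hR hkS hle hq (hyp kT hkT T R hT hR hTR)
  · obtain ⟨R, hR, hq, hSR⟩ := hT.exists_not_iso hkT hle ⟨fun e => hST.false e.symm⟩
    rw [deltaPA_comm]
    exact hT.deltaPA_pos_of_isLittleO hS hR hkT hle hq (hyp kS hkS S R hS hR hSR)

end
end

section
/- Fix positive integers a and b. Let B and Z be independent random variables with B ∼ Beta(a,b) and Z ∼ GGa(a+b+1, 2), and set V = 2BZ. Then P(V > t) ∼ c((a+b+2)/2, a) · t^{−1+a−b} · exp(−t²/4) as t → ∞, where c(x,y) = Γ(2x−2) / (2^{y−1} Γ(x−1/2) Γ(y)) and f(t) ∼ g(t) means f(t)/g(t) → 1. -/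
open MeasureTheory Filter Real
open scoped ENNReal

noncomputable section

/-- The constant `c(a,b) = Γ(2a-2) / (2^(b-1) Γ(a-1/2) Γ(b))`. -/
def cconst (a b : ℝ) : ℝ :=
  Real.Gamma (2 * a - 2) / ((2 : ℝ) ^ (b - 1) * Real.Gamma (a - 1 / 2) * Real.Gamma b)

/-- The beta distribution `Beta(a, b)`, with density proportional to
`x^(a-1) (1-x)^(b-1)` on `[0, 1]`. -/
def betaMeasure (a b : ℝ) : Measure ℝ :=
  volume.withDensity fun x =>
    ENNReal.ofReal (if 0 < x ∧ x < 1 then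
      (Real.Gamma (a + b) / (Real.Gamma a * Real.Gamma b)) * x ^ (a - 1) * (1 - x) ^ (b - 1)
    else 0)

/-- The generalized gamma distribution `GGa(a, b)`, with density proportional to
`x^(a-1) exp(-x^b)` on `(0, ∞)`. -/
def ggaMeasure (a b : ℝ) : Measure ℝ :=
  volume.withDensity fun x =>
    ENNReal.ofReal (if 0 < x then
      (b / Real.Gamma (a / b)) * x ^ (a - 1) * Real.exp (-(x ^ b))
    else 0)

theorem betaMeasure_real_Ioi (m n : ℕ) {r : ℝ} (hr0 : 0 < r) (hr1 : r < 1) :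
    (betaMeasure ((m + 1 : ℕ) : ℝ) ((n + 1 : ℕ) : ℝ)).real (Set.Ioi r) =
      Real.Gamma (((m + 1 : ℕ) : ℝ) + ((n + 1 : ℕ) : ℝ)) /
        (Real.Gamma ((m + 1 : ℕ) : ℝ) * Real.Gamma ((n + 1 : ℕ) : ℝ)) *
        ∫ x in r..1, x ^ m * (1 - x) ^ n := by
  set C := Real.Gamma (((m + 1 : ℕ) : ℝ) + ((n + 1 : ℕ) : ℝ)) /
        (Real.Gamma ((m + 1 : ℕ) : ℝ) * Real.Gamma ((n + 1 : ℕ) : ℝ))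
  have hCpos : 0 ≤ C := by positivity
  have hdens : Set.indicator (Set.Ioi r) (fun x : ℝ => ENNReal.ofReal (if 0 < x ∧ x < 1 then
      C * x ^ (((m + 1 : ℕ) : ℝ) - 1) * (1 - x) ^ (((n + 1 : ℕ) : ℝ) - 1) else 0)) =
      Set.indicator (Set.Ioo r 1) (fun x : ℝ => ENNReal.ofReal (C * (x ^ m * (1 - x) ^ n))) := by
    ext x
    by_cases h1 : r < x <;> by_cases h2 : x < 1
    · simp [h1, h2, hr0.trans h1, mul_assoc]
    all_goals simp [h1, h2]
  have hcont : Continuous fun x : ℝ => C * (x ^ m * (1 - x) ^ n) := by fun_prop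
  rw [measureReal_def, betaMeasure, withDensity_apply _ measurableSet_Ioi,
    ← lintegral_indicator measurableSet_Ioi, hdens, lintegral_indicator measurableSet_Ioo,
    ← intervalIntegral.integral_const_mul, intervalIntegral.integral_of_le hr1.le,
    integral_Ioc_eq_integral_Ioo, integral_eq_lintegral_of_nonneg_ae]
  · refine ae_restrict_of_forall_mem measurableSet_Ioo fun x hx => ?_
    have h1 : 0 ≤ x := (hr0.trans hx.1).le
    have h2 : 0 ≤ 1 - x := by linarith [hx.2]
    positivity
  · exact hcont.aestronglyMeasurable

theorem integral_one_sub_pow (n : ℕ) (r : ℝ) :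
    ∫ x in r..1, (1 - x) ^ n = (1 - r) ^ (n + 1) / (n + 1) := by
  rw [intervalIntegral.integral_comp_sub_left (fun x : ℝ => x ^ n) 1, integral_pow]
  simp

theorem integral_pow_mul_one_sub_pow_le (m n : ℕ) {r : ℝ} (hr0 : 0 < r) (hr1 : r < 1) :
    ∫ x in r..1, x ^ m * (1 - x) ^ n ≤ (1 - r) ^ (n + 1) / (n + 1) := by
  rw [← integral_one_sub_pow]
  refine intervalIntegral.integral_mono_on hr1.le
    (Continuous.intervalIntegrable (by fun_prop) _ _)
    (Continuous.intervalIntegrable (by fun_prop) _ _) fun x hx => ?_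
  have h2 : 0 ≤ 1 - x := by linarith [hx.2]
  exact mul_le_of_le_one_left (by positivity) (pow_le_one₀ (hr0.le.trans hx.1) hx.2)

theorem le_integral_pow_mul_one_sub_pow (m n : ℕ) {r : ℝ} (hr0 : 0 < r) (hr1 : r < 1) :
    r ^ m * ((1 - r) ^ (n + 1) / (n + 1)) ≤ ∫ x in r..1, x ^ m * (1 - x) ^ n := by
  rw [← integral_one_sub_pow, ← intervalIntegral.integral_const_mul]
  refine intervalIntegral.integral_mono_on hr1.le
    (Continuous.intervalIntegrable (by fun_prop) _ _)
    (Continuous.intervalIntegrable (by fun_prop) _ _) fun x hx => ?_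
  have h2 : 0 ≤ 1 - x := by linarith [hx.2]
  exact mul_le_mul_of_nonneg_right (pow_le_pow_left₀ hr0.le hx.1 m) (by positivity)

theorem betaMeasure_Ioi_of_one_le (a b : ℝ) {r : ℝ} (hr : 1 ≤ r) :
    (betaMeasure a b).real (Set.Ioi r) = 0 := by
  rw [measureReal_def, betaMeasure, withDensity_apply _ measurableSet_Ioi,
    setLIntegral_eq_zero measurableSet_Ioi]
  · simp
  · intro x hx
    have : ¬ x < 1 := not_lt.2 (hr.trans (le_of_lt hx))
    simp [this]

theorem betaMeasure_ne_zero (m n : ℕ) :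
    betaMeasure ((m + 1 : ℕ) : ℝ) ((n + 1 : ℕ) : ℝ) ≠ 0 := by
  intro h
  have h1 := betaMeasure_real_Ioi m n (r := 1 / 2) (by norm_num) (by norm_num)
  have h2 := le_integral_pow_mul_one_sub_pow m n (r := 1 / 2) (by norm_num) (by norm_num)
  rw [h] at h1
  have h3 : 0 < ∫ x in (1 / 2 : ℝ)..1, x ^ m * (1 - x) ^ n :=
    lt_of_lt_of_le (by norm_num; positivity) h2
  have h4 : 0 < Real.Gamma (((m + 1 : ℕ) : ℝ) + ((n + 1 : ℕ) : ℝ)) /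
        (Real.Gamma ((m + 1 : ℕ) : ℝ) * Real.Gamma ((n + 1 : ℕ) : ℝ)) := by positivity
  have := mul_pos h4 h3
  simp only [measureReal_zero, Pi.zero_apply] at h1
  linarith

/-- The real-valued density of `ggaMeasure a b`. -/
def ggaPDFReal (a b x : ℝ) : ℝ :=
  if 0 < x then (b / Real.Gamma (a / b)) * x ^ (a - 1) * Real.exp (-(x ^ b)) else 0

theorem measurable_ggaPDFReal (a b : ℝ) : Measurable (ggaPDFReal a b) :=
  Measurable.ite measurableSet_Ioi (by fun_prop) measurable_const

theorem ggaPDFReal_pos {a b x : ℝ} (ha : 0 < a) (hb : 0 < b) (hx : 0 < x) :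
    0 < ggaPDFReal a b x := by
  rw [ggaPDFReal, if_pos hx]
  have := Real.Gamma_pos_of_pos (div_pos ha hb)
  positivity

theorem ggaPDFReal_of_nonpos {a b x : ℝ} (hx : x ≤ 0) : ggaPDFReal a b x = 0 :=
  if_neg hx.not_gt

theorem ggaPDFReal_nonneg {a b : ℝ} (ha : 0 < a) (hb : 0 < b) (x : ℝ) :
    0 ≤ ggaPDFReal a b x := by
  rcases lt_or_ge 0 x with hx | hx
  · exact (ggaPDFReal_pos ha hb hx).le
  · exact (ggaPDFReal_of_nonpos hx).ge

theorem ggaMeasure_eq (a b : ℝ) :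
    ggaMeasure a b = volume.withDensity fun x => ENNReal.ofReal (ggaPDFReal a b x) := rfl

theorem ggaMeasure_ne_zero {a b : ℝ} (ha : 0 < a) (hb : 0 < b) : ggaMeasure a b ≠ 0 := by
  intro h
  rw [ggaMeasure_eq, withDensity_eq_zero_iff
    (measurable_ggaPDFReal a b).ennreal_ofReal.aemeasurable] at h
  have h0 : volume (Set.Ioi (0 : ℝ)) = 0 := by
    refine measure_mono_null (fun x hx => ?_) (ae_iff.1 h)
    simpa using ggaPDFReal_pos ha hb hx
  simp at h0

/-- Conditioning on the second factor: the tail of a product of independent variables. -/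
theorem prob_lt_mul_eq_integral {Ω : Type} [MeasurableSpace Ω] (P : Measure Ω)
    [IsProbabilityMeasure P] {B Z : Ω → ℝ} (hind : ProbabilityTheory.IndepFun B Z P)
    (hBm : AEMeasurable B P) (hZm : AEMeasurable Z P) {c d : ℝ} (hc : 0 < c) (hd : 0 < d)
    (hZ : P.map Z = ggaMeasure c d) (s : ℝ) :
    P.real {ω | s < B ω * Z ω} =
      ∫ z, ggaPDFReal c d z * (P.map B).real {x | s < x * z} := by
  have hB' : IsProbabilityMeasure (P.map B) := Measure.isProbabilityMeasure_map hBm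
  have hZ' : IsProbabilityMeasure (P.map Z) := Measure.isProbabilityMeasure_map hZm
  have hS : MeasurableSet {p : ℝ × ℝ | s < p.1 * p.2} :=
    measurableSet_lt measurable_const (by fun_prop)
  have hprod := (ProbabilityTheory.indepFun_iff_map_prod_eq_prod_map_map hBm hZm).1 hind
  have h1 : P {ω | s < B ω * Z ω} = ((P.map B).prod (P.map Z)) {p : ℝ × ℝ | s < p.1 * p.2} := by
    rw [← hprod, Measure.map_apply_of_aemeasurable (hBm.prodMk hZm) hS]
    rfl
  have hmeas : Measurable fun z : ℝ => (P.map B) {x | s < x * z} :=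
    measurable_measure_prodMk_right hS
  rw [measureReal_def, h1, Measure.prod_apply_symm hS]
  change (∫⁻ z, (P.map B) {x | s < x * z} ∂(P.map Z)).toReal = _
  rw [← integral_toReal hmeas.aemeasurable (ae_of_all _ fun z => measure_lt_top _ _), hZ,
    ggaMeasure_eq, integral_withDensity_eq_integral_toReal_smul
      (measurable_ggaPDFReal c d).ennreal_ofReal (ae_of_all _ fun z => ENNReal.ofReal_lt_top)]
  refine integral_congr_ae (ae_of_all _ fun z => ?_)
  simp [ENNReal.toReal_ofReal (ggaPDFReal_nonneg hc hd z), measureReal_def]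

theorem betaMeasure_real_setOf_lt_mul (m n : ℕ) {s u : ℝ} (hs : 0 < s) (hu : 0 < u) :
    (betaMeasure ((m + 1 : ℕ) : ℝ) ((n + 1 : ℕ) : ℝ)).real {x | s < x * (s * (1 + u))} =
      Real.Gamma (((m + 1 : ℕ) : ℝ) + ((n + 1 : ℕ) : ℝ)) /
        (Real.Gamma ((m + 1 : ℕ) : ℝ) * Real.Gamma ((n + 1 : ℕ) : ℝ)) *
        ∫ x in (1 / (1 + u))..1, x ^ m * (1 - x) ^ n := by
  have hset : {x : ℝ | s < x * (s * (1 + u))} = Set.Ioi (1 / (1 + u)) := by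
    ext x
    rw [Set.mem_ofPred_eq, Set.mem_Ioi, div_lt_iff₀ (by positivity),
      show x * (s * (1 + u)) = s * (x * (1 + u)) by ring]
    constructor <;> intro h <;> nlinarith
  rw [hset, betaMeasure_real_Ioi m n (by positivity)
    (by rw [div_lt_one (by positivity)]; linarith)]

/-- The product of the normalizing constants of `Beta(m+1, n+1)` and `GGa(m+n+3, 2)`, divided by
`n + 1`. -/
def tailDensityConst (m n : ℕ) : ℝ :=
  2 / Real.Gamma ((((m + 1 : ℕ) : ℝ) + ((n + 1 : ℕ) : ℝ) + 1) / 2) *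
    (Real.Gamma (((m + 1 : ℕ) : ℝ) + ((n + 1 : ℕ) : ℝ)) /
        (Real.Gamma ((m + 1 : ℕ) : ℝ) * Real.Gamma ((n + 1 : ℕ) : ℝ))) / (n + 1)

theorem tailDensityConst_pos (m n : ℕ) : 0 < tailDensityConst m n := by
  have : 0 < Real.Gamma ((((m + 1 : ℕ) : ℝ) + ((n + 1 : ℕ) : ℝ) + 1) / 2) :=
    Real.Gamma_pos_of_pos (by positivity)
  unfold tailDensityConst
  positivity

/-- The integrand of the tail probability `P(BZ > s)`, rescaled around `z = s`. -/
def scaledIntegrand (m n : ℕ) (s w : ℝ) : ℝ :=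
  Real.exp (s ^ 2) * s ^ n / s ^ m *
    (ggaPDFReal (((m + 1 : ℕ) : ℝ) + ((n + 1 : ℕ) : ℝ) + 1) 2 (s + s⁻¹ * w) *
      (betaMeasure ((m + 1 : ℕ) : ℝ) ((n + 1 : ℕ) : ℝ)).real {x | s < x * (s + s⁻¹ * w)})

theorem scaledIntegrand_eq (m n : ℕ) {s w : ℝ} (hs : 0 < s) (hw : 0 < w) :
    scaledIntegrand m n s w = tailDensityConst m n * Real.exp (-(2 * w) - w ^ 2 / s ^ 2) *
      (s ^ (n + 1) * s ^ (n + 1) * (1 + w / s ^ 2) ^ (m + n + 2) *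
        ((n + 1) * ∫ x in (1 / (1 + w / s ^ 2))..1, x ^ m * (1 - x) ^ n)) := by
  have hu : 0 < w / s ^ 2 := by positivity
  have hz : s + s⁻¹ * w = s * (1 + w / s ^ 2) := by field_simp
  rw [scaledIntegrand, hz, betaMeasure_real_setOf_lt_mul m n hs hu, ggaPDFReal,
    if_pos (by positivity)]
  have hpow : (s * (1 + w / s ^ 2)) ^ (((m + 1 : ℕ) : ℝ) + ((n + 1 : ℕ) : ℝ) + 1 - 1) =
      s ^ m * s ^ (n + 2) * (1 + w / s ^ 2) ^ (m + n + 2) := by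
    rw [add_sub_cancel_right, ← Nat.cast_add, Real.rpow_natCast, mul_pow]
    ring
  have hexp : Real.exp (-((s * (1 + w / s ^ 2)) ^ (2 : ℝ))) =
      Real.exp (-(s ^ 2)) * Real.exp (-(2 * w) - w ^ 2 / s ^ 2) := by
    rw [← Real.exp_add, Real.rpow_two]
    congr 1
    field_simp
    ring
  rw [hpow, hexp, Real.exp_neg (s ^ 2), tailDensityConst]
  field_simp
  ring

theorem scaledIntegrand_le (m n : ℕ) {s w : ℝ} (hs : 0 < s) (hw : 0 < w) :
    scaledIntegrand m n s w ≤ tailDensityConst m n * Real.exp (-(2 * w) - w ^ 2 / s ^ 2) *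
      (w ^ (n + 1) * (1 + w / s ^ 2) ^ (m + 1)) := by
  have hu : 0 < w / s ^ 2 := by positivity
  have hD := tailDensityConst_pos m n
  rw [scaledIntegrand_eq m n hs hw]
  have hI := integral_pow_mul_one_sub_pow_le m n (r := 1 / (1 + w / s ^ 2)) (by positivity)
    (by rw [div_lt_one (by positivity)]; linarith)
  refine mul_le_mul_of_nonneg_left ?_ (by positivity)
  refine (mul_le_mul_of_nonneg_left (mul_le_mul_of_nonneg_left hI (by positivity))
    (by positivity)).trans_eq ?_
  have h1 : 1 - 1 / (1 + w / s ^ 2) = w / s ^ 2 / (1 + w / s ^ 2) := by field_simp; ring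
  have h2 : (1 + w / s ^ 2) ^ (m + n + 2) =
      (1 + w / s ^ 2) ^ (m + 1) * (1 + w / s ^ 2) ^ (n + 1) := by ring
  have h3 : s ^ (n + 1) * s ^ (n + 1) = (s ^ 2) ^ (n + 1) := by rw [← mul_pow, sq]
  have h4 : (1 + w / s ^ 2) ^ (n + 1) ≠ 0 := by positivity
  have h5 : (s ^ 2) ^ (n + 1) ≠ 0 := by positivity
  rw [h1, div_pow, div_pow, h2, h3]
  generalize (1 + w / s ^ 2) ^ (n + 1) = A at *
  generalize (s ^ 2) ^ (n + 1) = A' at *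
  field_simp

theorem le_scaledIntegrand (m n : ℕ) {s w : ℝ} (hs : 0 < s) (hw : 0 < w) :
    tailDensityConst m n * Real.exp (-(2 * w) - w ^ 2 / s ^ 2) * w ^ (n + 1) ≤
      scaledIntegrand m n s w := by
  have hu : 0 < w / s ^ 2 := by positivity
  have hD := tailDensityConst_pos m n
  rw [scaledIntegrand_eq m n hs hw]
  have hI := le_integral_pow_mul_one_sub_pow m n (r := 1 / (1 + w / s ^ 2)) (by positivity)
    (by rw [div_lt_one (by positivity)]; linarith)
  refine mul_le_mul_of_nonneg_left ?_ (by positivity)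
  refine le_trans ?_ (mul_le_mul_of_nonneg_left (mul_le_mul_of_nonneg_left hI (by positivity))
    (by positivity))
  have h1 : 1 - 1 / (1 + w / s ^ 2) = w / s ^ 2 / (1 + w / s ^ 2) := by field_simp; ring
  have h2 : (1 + w / s ^ 2) ^ (m + n + 2) =
      (1 + w / s ^ 2) * (1 + w / s ^ 2) ^ m * (1 + w / s ^ 2) ^ (n + 1) := by ring
  have h3 : s ^ (n + 1) * s ^ (n + 1) = (s ^ 2) ^ (n + 1) := by rw [← mul_pow, sq]
  have h4 : (1 + w / s ^ 2) ^ (n + 1) ≠ 0 := by positivity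
  have h5 : (s ^ 2) ^ (n + 1) ≠ 0 := by positivity
  have h6 : (1 + w / s ^ 2) ^ m ≠ 0 := by positivity
  have h7 : w ^ (n + 1) ≤ w ^ (n + 1) * (1 + w / s ^ 2) :=
    le_mul_of_one_le_right (by positivity) (by linarith)
  refine h7.trans_eq ?_
  rw [h1, div_pow, div_pow, div_pow, h2, h3, one_pow]
  generalize (1 + w / s ^ 2) ^ (n + 1) = A at *
  generalize (1 + w / s ^ 2) ^ m = A'' at *
  generalize (s ^ 2) ^ (n + 1) = A' at *
  generalize (1 + w / s ^ 2) = q at *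
  field_simp

theorem scaledIntegrand_of_nonpos (m n : ℕ) {s w : ℝ} (hs : 0 < s) (hw : w ≤ 0) :
    scaledIntegrand m n s w = 0 := by
  have hz : s + s⁻¹ * w ≤ s := by
    have : s⁻¹ * w ≤ 0 := mul_nonpos_of_nonneg_of_nonpos (by positivity) hw
    linarith
  rw [scaledIntegrand]
  rcases le_or_gt (s + s⁻¹ * w) 0 with h0 | h0
  · simp [ggaPDFReal_of_nonpos h0]
  · have hset : {x : ℝ | s < x * (s + s⁻¹ * w)} = Set.Ioi (s / (s + s⁻¹ * w)) := by
      ext x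
      rw [Set.mem_ofPred_eq, Set.mem_Ioi, div_lt_iff₀ h0]
    rw [hset, betaMeasure_Ioi_of_one_le _ _ ((one_le_div h0).2 hz)]
    simp

theorem norm_scaledIntegrand_le (m n : ℕ) {s : ℝ} (hs : 1 ≤ s) (w : ℝ) :
    ‖scaledIntegrand m n s w‖ ≤ (Set.Ioi (0 : ℝ)).indicator (fun w =>
      tailDensityConst m n * (m + n + 2).factorial * Real.exp 1 * Real.exp (-w)) w := by
  have hs0 : 0 < s := by linarith
  have hD := tailDensityConst_pos m n
  rcases le_or_gt w 0 with hw | hw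
  · simp [scaledIntegrand_of_nonpos m n hs0 hw, hw.not_gt]
  · have hnn : 0 ≤ scaledIntegrand m n s w :=
      le_trans (by positivity) (le_scaledIntegrand m n hs0 hw)
    rw [Set.indicator_of_mem (Set.mem_Ioi.2 hw), Real.norm_of_nonneg hnn]
    refine (scaledIntegrand_le m n hs0 hw).trans ?_
    have hu : w / s ^ 2 ≤ w := div_le_self hw.le (one_le_pow₀ hs)
    have h1 : w ^ (n + 1) * (1 + w / s ^ 2) ^ (m + 1) ≤
        (m + n + 2).factorial * Real.exp (1 + w) := by
      calc w ^ (n + 1) * (1 + w / s ^ 2) ^ (m + 1)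
          ≤ (1 + w) ^ (n + 1) * (1 + w) ^ (m + 1) := by gcongr; linarith
        _ = (1 + w) ^ (m + n + 2) := by ring
        _ ≤ (m + n + 2).factorial * Real.exp (1 + w) := by
          have := Real.pow_div_factorial_le_exp (1 + w) (by positivity) (m + n + 2)
          rwa [div_le_iff₀' (by positivity)] at this
    have h2 : Real.exp (-(2 * w) - w ^ 2 / s ^ 2) ≤ Real.exp (-(2 * w)) :=
      Real.exp_le_exp.2 (sub_le_self _ (by positivity))
    calc _ ≤ tailDensityConst m n * Real.exp (-(2 * w)) *
          ((m + n + 2).factorial * Real.exp (1 + w)) := by gcongr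
      _ = tailDensityConst m n * (m + n + 2).factorial *
          (Real.exp (-(2 * w)) * Real.exp (1 + w)) := by ring
      _ = tailDensityConst m n * (m + n + 2).factorial * (Real.exp 1 * Real.exp (-w)) := by
        rw [← Real.exp_add, ← Real.exp_add]
        ring_nf
      _ = _ := by ring

theorem tendsto_scaledIntegrand (m n : ℕ) (w : ℝ) :
    Tendsto (fun s => scaledIntegrand m n s w) atTop
      (nhds ((Set.Ioi (0 : ℝ)).indicator
        (fun w => tailDensityConst m n * (w ^ (n + 1) * Real.exp (-(2 * w)))) w)) := by
  rcases le_or_gt w 0 with hw | hw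
  · rw [Set.indicator_of_notMem (by simpa using hw)]
    refine tendsto_const_nhds.congr' ?_
    filter_upwards [eventually_gt_atTop 0] with s hs
    rw [scaledIntegrand_of_nonpos m n hs hw]
  · rw [Set.indicator_of_mem (Set.mem_Ioi.2 hw)]
    have hinv : ∀ c : ℝ, Tendsto (fun s : ℝ => c / s ^ 2) atTop (nhds 0) := fun c =>
      tendsto_const_nhds.div_atTop (tendsto_pow_atTop two_ne_zero)
    have hexp : Tendsto (fun s : ℝ => Real.exp (-(2 * w) - w ^ 2 / s ^ 2)) atTop
        (nhds (Real.exp (-(2 * w)))) := by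
      simpa [Function.comp_def] using
        (Real.continuous_exp.tendsto _).comp ((hinv (w ^ 2)).const_sub (-(2 * w)))
    refine tendsto_of_tendsto_of_tendsto_of_le_of_le'
      (g := fun s => tailDensityConst m n * Real.exp (-(2 * w) - w ^ 2 / s ^ 2) * w ^ (n + 1))
      (h := fun s => tailDensityConst m n * Real.exp (-(2 * w) - w ^ 2 / s ^ 2) *
        (w ^ (n + 1) * (1 + w / s ^ 2) ^ (m + 1))) ?_ ?_ ?_ ?_
    · convert (hexp.const_mul (tailDensityConst m n)).mul_const (w ^ (n + 1)) using 2
      ring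
    · convert (hexp.const_mul (tailDensityConst m n)).mul
        ((((hinv w).const_add 1).pow (m + 1)).const_mul (w ^ (n + 1))) using 2
      simp
      ring
    · filter_upwards [eventually_gt_atTop 0] with s hs using le_scaledIntegrand m n hs hw
    · filter_upwards [eventually_gt_atTop 0] with s hs using scaledIntegrand_le m n hs hw

theorem measurable_scaledIntegrand (m n : ℕ)
    [SFinite (betaMeasure ((m + 1 : ℕ) : ℝ) ((n + 1 : ℕ) : ℝ))] (s : ℝ) :
    Measurable (scaledIntegrand m n s) := by
  have hS : MeasurableSet {p : ℝ × ℝ | s < p.1 * p.2} :=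
    measurableSet_lt measurable_const (by fun_prop)
  have h1 : Measurable fun z : ℝ =>
      (betaMeasure ((m + 1 : ℕ) : ℝ) ((n + 1 : ℕ) : ℝ)).real {x | s < x * z} :=
    (measurable_measure_prodMk_right hS).ennreal_toReal
  have h2 : Measurable fun w : ℝ => s + s⁻¹ * w := by fun_prop
  exact (((measurable_ggaPDFReal _ _).comp h2).mul (h1.comp h2)).const_mul _

theorem integral_Ioi_pow_mul_exp_neg_two_mul (n : ℕ) :
    ∫ w in Set.Ioi (0 : ℝ), w ^ (n + 1) * Real.exp (-(2 * w)) =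
      (n + 1) * Real.Gamma ((n + 1 : ℕ) : ℝ) / 2 ^ (n + 2) := by
  have h := Real.integral_rpow_mul_exp_neg_mul_Ioi (a := ((n + 2 : ℕ) : ℝ)) (r := 2)
    (by positivity) two_pos
  have h1 : ((n + 2 : ℕ) : ℝ) - 1 = ((n + 1 : ℕ) : ℝ) := by push_cast; ring
  have h2 : Real.Gamma ((n + 2 : ℕ) : ℝ) = (n + 1) * Real.Gamma ((n + 1 : ℕ) : ℝ) := by
    rw [show ((n + 2 : ℕ) : ℝ) = ((n + 1 : ℕ) : ℝ) + 1 by push_cast; ring,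
      Real.Gamma_add_one (by positivity)]
    push_cast
    ring
  rw [h1, h2, Real.rpow_natCast] at h
  simp only [Real.rpow_natCast] at h
  rw [h, one_div, inv_pow]
  ring

theorem tendsto_integral_scaledIntegrand (m n : ℕ)
    [SFinite (betaMeasure ((m + 1 : ℕ) : ℝ) ((n + 1 : ℕ) : ℝ))] :
    Tendsto (fun s => ∫ w, scaledIntegrand m n s w) atTop
      (nhds (tailDensityConst m n *
        ((n + 1) * Real.Gamma ((n + 1 : ℕ) : ℝ) / 2 ^ (n + 2)))) := by
  rw [← integral_Ioi_pow_mul_exp_neg_two_mul, ← integral_const_mul,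
    ← integral_indicator measurableSet_Ioi]
  refine tendsto_integral_filter_of_dominated_convergence
    ((Set.Ioi (0 : ℝ)).indicator fun w =>
      tailDensityConst m n * (m + n + 2).factorial * Real.exp 1 * Real.exp (-w))
    (Eventually.of_forall fun s => (measurable_scaledIntegrand m n s).aestronglyMeasurable)
    ?_ ?_ (ae_of_all _ fun w => tendsto_scaledIntegrand m n w)
  · filter_upwards [eventually_ge_atTop 1] with s hs
    exact ae_of_all _ fun w => norm_scaledIntegrand_le m n hs w
  · exact (integrable_indicator_iff measurableSet_Ioi).2
      ((integrableOn_exp_neg_Ioi 0).const_mul _)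

theorem integral_scaledIntegrand (m n : ℕ) {s : ℝ} (hs : 0 < s) :
    ∫ w, scaledIntegrand m n s w = Real.exp (s ^ 2) * s ^ (n + 1) / s ^ m *
      ∫ z, ggaPDFReal (((m + 1 : ℕ) : ℝ) + ((n + 1 : ℕ) : ℝ) + 1) 2 z *
        (betaMeasure ((m + 1 : ℕ) : ℝ) ((n + 1 : ℕ) : ℝ)).real {x | s < x * z} := by
  simp only [scaledIntegrand]
  rw [integral_const_mul, Measure.integral_comp_mul_left (fun v =>
    ggaPDFReal (((m + 1 : ℕ) : ℝ) + ((n + 1 : ℕ) : ℝ) + 1) 2 (s + v) *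
      (betaMeasure ((m + 1 : ℕ) : ℝ) ((n + 1 : ℕ) : ℝ)).real {x | s < x * (s + v)}),
    integral_add_left_eq_self (fun z =>
      ggaPDFReal (((m + 1 : ℕ) : ℝ) + ((n + 1 : ℕ) : ℝ) + 1) 2 z *
        (betaMeasure ((m + 1 : ℕ) : ℝ) ((n + 1 : ℕ) : ℝ)).real {x | s < x * z}),
    inv_inv, abs_of_pos hs, smul_eq_mul, pow_succ]
  ring

/-- If `B ~ Beta(a, b)` and `Z ~ GGa(a+b+1, 2)` are independent and `V = 2BZ`, then
`P(V > t) ∼ c((a+b+2)/2, a) t^(-1+a-b) exp(-t²/4)` as `t → ∞`. -/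
theorem tail_two_mul_beta_gga
    (a b : ℕ) (ha : 0 < a) (hb : 0 < b)
    {Ω : Type} [MeasurableSpace Ω] (P : Measure Ω) [IsProbabilityMeasure P]
    (B Z : Ω → ℝ)
    (hind : ProbabilityTheory.IndepFun B Z P)
    (hB : P.map B = betaMeasure (a : ℝ) (b : ℝ))
    (hZ : P.map Z = ggaMeasure ((a : ℝ) + b + 1) 2) :
    Filter.Tendsto (fun t : ℝ =>
        (P {ω | t < 2 * B ω * Z ω}).toReal /
          (cconst (((a : ℝ) + b + 2) / 2) (a : ℝ) * t ^ ((-1 : ℝ) + a - b) *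
            Real.exp (-t ^ 2 / 4)))
      Filter.atTop (nhds 1) := by
  obtain ⟨m, rfl⟩ := Nat.exists_eq_succ_of_ne_zero ha.ne'
  obtain ⟨n, rfl⟩ := Nat.exists_eq_succ_of_ne_zero hb.ne'
  simp only [Nat.succ_eq_add_one] at *
  have hc : (0 : ℝ) < ((m + 1 : ℕ) : ℝ) + ((n + 1 : ℕ) : ℝ) + 1 := by positivity
  have hBm : AEMeasurable B P := AEMeasurable.of_map_ne_zero (hB ▸ betaMeasure_ne_zero m n)
  have hZm : AEMeasurable Z P := AEMeasurable.of_map_ne_zero (hZ ▸ ggaMeasure_ne_zero hc two_pos)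
  have hprob : IsProbabilityMeasure (betaMeasure ((m + 1 : ℕ) : ℝ) ((n + 1 : ℕ) : ℝ)) :=
    hB ▸ Measure.isProbabilityMeasure_map hBm
  have hlim := (tendsto_integral_scaledIntegrand m n).comp
    (tendsto_id.atTop_div_const (two_pos : (0 : ℝ) < 2))
  have hL : 0 < tailDensityConst m n *
      ((n + 1) * Real.Gamma ((n + 1 : ℕ) : ℝ) / 2 ^ (n + 2)) := by
    have := tailDensityConst_pos m n
    positivity
  have hlim' := hlim.div_const (tailDensityConst m n *
      ((n + 1) * Real.Gamma ((n + 1 : ℕ) : ℝ) / 2 ^ (n + 2)))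
  rw [div_self hL.ne'] at hlim'
  refine hlim'.congr' ?_
  filter_upwards [eventually_gt_atTop 0] with t ht
  have hset : {ω | t < 2 * B ω * Z ω} = {ω | t / 2 < B ω * Z ω} := by
    ext ω
    rw [Set.mem_ofPred_eq, Set.mem_ofPred_eq, div_lt_iff₀ two_pos]
    ring_nf
  have hP := prob_lt_mul_eq_integral P hind hBm hZm hc two_pos hZ (t / 2)
  rw [hB] at hP
  rw [Function.comp_apply, id, integral_scaledIntegrand m n (half_pos ht), ← hP, hset,
    ← measureReal_def]
  have hrpow : t ^ ((-1 : ℝ) + ((m + 1 : ℕ) : ℝ) - ((n + 1 : ℕ) : ℝ)) = t ^ m / t ^ (n + 1) := by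
    rw [Real.rpow_sub ht, Real.rpow_natCast,
      show (-1 : ℝ) + ((m + 1 : ℕ) : ℝ) = (m : ℝ) by push_cast; ring, Real.rpow_natCast]
  have hconst : cconst ((((m + 1 : ℕ) : ℝ) + ((n + 1 : ℕ) : ℝ) + 2) / 2) ((m + 1 : ℕ) : ℝ) =
      tailDensityConst m n * ((n + 1) * Real.Gamma ((n + 1 : ℕ) : ℝ)) / (2 * 2 ^ m) := by
    have h1 : 2 * ((((m + 1 : ℕ) : ℝ) + ((n + 1 : ℕ) : ℝ) + 2) / 2) - 2 =
        ((m + 1 : ℕ) : ℝ) + ((n + 1 : ℕ) : ℝ) := by ring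
    have h2 : (((m + 1 : ℕ) : ℝ) + ((n + 1 : ℕ) : ℝ) + 2) / 2 - 1 / 2 =
        (((m + 1 : ℕ) : ℝ) + ((n + 1 : ℕ) : ℝ) + 1) / 2 := by ring
    have h3 : ((m + 1 : ℕ) : ℝ) - 1 = (m : ℝ) := by push_cast; ring
    have h4 : Real.Gamma ((n + 1 : ℕ) : ℝ) ≠ 0 := by positivity
    rw [cconst, h1, h2, h3, Real.rpow_natCast, tailDensityConst]
    field_simp
  have hexp : Real.exp (-t ^ 2 / 4) = (Real.exp ((t / 2) ^ 2))⁻¹ := by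
    rw [← Real.exp_neg]
    ring_nf
  rw [hrpow, hconst, hexp, div_pow t 2 m, div_pow t 2 (n + 1)]
  have hD := (tailDensityConst_pos m n).ne'
  have hG : Real.Gamma ((n + 1 : ℕ) : ℝ) ≠ 0 := by positivity
  field_simp
  ring

end
end
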